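/- Let G be a connected decomposable claw-free graph with maximum degree 3 such that χ'_irr(G) > 3 and every decomposable claw-free graph with maximum degree at most 3 and fewer edges than G has locally irregular chromatic index at most 3. Then G contains no triangle incident with a vertex of degree 2 and no triangle one of whose vertices is adjacent to a vertex of degree 1. -/

import Mathlib

/-- A graph is *locally irregular* if no two adjacent vertices have the same degree. -/
def LocallyIrregular {V : Type*} (G : SimpleGraph V) : Prop :=
  ∀ ⦃u v : V⦄, G.Adj u v → (G.neighborSet u).ncard ≠ (G.neighborSet v).ncard

/-- `HasLIEC G k` : `G` admits a locally irregular edge-coloring using at most `k` colors,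
i.e. an assignment of one of `k` colors to every edge such that the edges of each fixed
color induce a locally irregular graph. -/
def HasLIEC {V : Type*} (G : SimpleGraph V) (k : ℕ) : Prop :=
  ∃ c : Sym2 V → Fin k, ∀ i : Fin k,
    LocallyIrregular (SimpleGraph.fromEdgeSet {e | e ∈ G.edgeSet ∧ c e = i})

/-- A graph is *decomposable* if it admits a locally irregular edge-coloring. -/
def Decomposable {V : Type*} (G : SimpleGraph V) : Prop :=
  ∃ k : ℕ, HasLIEC G k

/-- A graph is *claw-free* if it contains no induced subgraph isomorphic to `K_{1,3}`. -/
def ClawFree {V : Type*} (G : SimpleGraph V) : Prop :=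
  ¬ ∃ v a b c : V, a ≠ b ∧ a ≠ c ∧ b ≠ c ∧
      G.Adj v a ∧ G.Adj v b ∧ G.Adj v c ∧ ¬ G.Adj a b ∧ ¬ G.Adj a c ∧ ¬ G.Adj b c

/-- `G` has maximum degree at most `d`. -/
def MaxDegreeLE {V : Type*} (G : SimpleGraph V) (d : ℕ) : Prop :=
  ∀ v : V, (G.neighborSet v).ncard ≤ d


namespace LIE

open Classical

variable {V : Type*} {κ : Type*}

/-- induced subgraph on `S`, on the same vertex type -/
def ind (G : SimpleGraph V) (S : Set V) : SimpleGraph V where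
  Adj u v := G.Adj u v ∧ u ∈ S ∧ v ∈ S
  symm := ⟨fun _ _ h => ⟨h.1.symm, h.2.2, h.2.1⟩⟩
  loopless := ⟨fun _ h => G.loopless.irrefl _ h.1⟩

/-- star at `v` with leaves in `S` -/
def stG (G : SimpleGraph V) (v : V) (S : Set V) : SimpleGraph V where
  Adj x y := G.Adj x y ∧ ((x = v ∧ y ∈ S) ∨ (y = v ∧ x ∈ S))
  symm := ⟨fun _ _ h => ⟨h.1.symm, h.2.symm⟩⟩
  loopless := ⟨fun _ h => G.loopless.irrefl _ h.1⟩

theorem ind_adj {G : SimpleGraph V} {S : Set V} {u v : V} :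
    (ind G S).Adj u v ↔ G.Adj u v ∧ u ∈ S ∧ v ∈ S := Iff.rfl

theorem stG_adj {G : SimpleGraph V} {S : Set V} {v x y : V} :
    (stG G v S).Adj x y ↔ G.Adj x y ∧ ((x = v ∧ y ∈ S) ∨ (y = v ∧ x ∈ S)) := Iff.rfl

/-- color degree -/
noncomputable def cd (G : SimpleGraph V) (c : Sym2 V → κ) (v : V) (i : κ) : ℕ :=
  {w | G.Adj v w ∧ c s(v, w) = i}.ncard

def LI (G : SimpleGraph V) (c : Sym2 V → κ) : Prop :=
  ∀ u v, G.Adj u v → cd G c u (c s(u, v)) ≠ cd G c v (c s(u, v))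

def Dec (G : SimpleGraph V) : Prop := ∃ c : Sym2 V → ℕ, LI G c
def Col (G : SimpleGraph V) : Prop := ∃ c : Sym2 V → Fin 3, LI G c

theorem hasLIEC_iff (G : SimpleGraph V) (k : ℕ) :
    HasLIEC G k ↔ ∃ c : Sym2 V → Fin k, LI G c := by
  have key : ∀ (c : Sym2 V → Fin k) (i : Fin k) (u : V),
      (SimpleGraph.fromEdgeSet {e | e ∈ G.edgeSet ∧ c e = i}).neighborSet u
        = {w | G.Adj u w ∧ c s(u, w) = i} := by
    intro c i u
    ext w
    simp only [SimpleGraph.mem_neighborSet, SimpleGraph.fromEdgeSet_adj, Set.mem_ofPred_eq,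
      SimpleGraph.mem_edgeSet]
    constructor
    · exact fun h => h.1
    · exact fun h => ⟨h, h.1.ne⟩
  unfold HasLIEC LocallyIrregular LI cd
  simp only [key]
  constructor
  · rintro ⟨c, hc⟩
    refine ⟨c, fun u v h => hc (c s(u, v)) ?_⟩
    rw [SimpleGraph.fromEdgeSet_adj]
    exact ⟨⟨h, rfl⟩, h.ne⟩
  · rintro ⟨c, hc⟩
    refine ⟨c, fun i u v h => ?_⟩
    rw [SimpleGraph.fromEdgeSet_adj] at h
    obtain ⟨⟨h1, rfl⟩, _⟩ := h
    exact hc u v h1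

theorem LI_inj {κ' : Type*} {G : SimpleGraph V} {c : Sym2 V → κ} (h : LI G c) (σ : κ → κ')
    (hσ : Function.Injective σ) : LI G (fun e => σ (c e)) := by
  intro u v huv
  have := h u v huv
  unfold cd at *
  simpa only [hσ.eq_iff] using this

theorem dec_of_decomposable {G : SimpleGraph V} (h : Decomposable G) : Dec G := by
  obtain ⟨k, hk⟩ := h
  obtain ⟨c, hc⟩ := (hasLIEC_iff G k).1 hk
  exact ⟨_, LI_inj hc _ Fin.val_injective⟩

theorem decomposable_of_dec [Fintype V] {G : SimpleGraph V} (h : Dec G) : Decomposable G := by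
  obtain ⟨c, hc⟩ := h
  let k := Finset.univ.sup c
  have hk : ∀ e, c e < k + 1 := fun e => Nat.lt_succ_of_le (Finset.le_sup (Finset.mem_univ e))
  refine ⟨k + 1, (hasLIEC_iff G _).2 ⟨fun e => ⟨c e, hk e⟩, ?_⟩⟩
  intro u v huv
  have := hc u v huv
  unfold cd at *
  simpa only [Fin.mk.injEq] using this

theorem Col.fix {G : SimpleGraph V} (h : Col G) (e : Sym2 V) (j : Fin 3) :
    ∃ c : Sym2 V → Fin 3, LI G c ∧ c e = j := by
  obtain ⟨c, hc⟩ := h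
  exact ⟨_, LI_inj hc (Equiv.swap (c e) j) (Equiv.injective _), by simp⟩

theorem LI_restrict {G H : SimpleGraph V} {c : Sym2 V → κ} (hc : LI G c) (hHG : H ≤ G)
    (hcl : ∀ v w w', H.Adj v w → G.Adj v w' → ¬ H.Adj v w' → c s(v, w) ≠ c s(v, w')) :
    LI H c := by
  have key : ∀ v w, H.Adj v w → cd H c v (c s(v, w)) = cd G c v (c s(v, w)) := by
    intro v w hvw
    unfold cd
    congr 1
    ext x
    constructor
    · exact fun h => ⟨hHG h.1, h.2⟩
    · rintro ⟨h1, h2⟩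
      refine ⟨?_, h2⟩
      by_contra h3
      exact hcl v w x hvw h1 h3 h2.symm
  intro u v huv
  have h1 := key u v huv
  have h2 := key v u huv.symm
  rw [Sym2.eq_swap] at h2
  rw [h1, h2]
  exact hc u v (hHG huv)

theorem glue {G H₁ H₂ : SimpleGraph V} {c₁ c₂ : Sym2 V → κ}
    (hG : ∀ u v, G.Adj u v ↔ H₁.Adj u v ∨ H₂.Adj u v)
    (hd : ∀ u v, H₁.Adj u v → ¬ H₂.Adj u v)
    (h₁ : LI H₁ c₁) (h₂ : LI H₂ c₂)
    (hc : ∀ v w w', H₁.Adj v w → H₂.Adj v w' → c₁ s(v, w) ≠ c₂ s(v, w')) :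
    ∃ c : Sym2 V → κ, LI G c ∧ (∀ u v, H₁.Adj u v → c s(u, v) = c₁ s(u, v)) ∧
      (∀ u v, H₂.Adj u v → c s(u, v) = c₂ s(u, v)) := by
  let c : Sym2 V → κ := fun e => if e ∈ H₁.edgeSet then c₁ e else c₂ e
  have e1 : ∀ u v, H₁.Adj u v → c s(u, v) = c₁ s(u, v) := by
    intro u v h; simp [c, h]
  have e2 : ∀ u v, H₂.Adj u v → c s(u, v) = c₂ s(u, v) := by
    intro u v h
    have : ¬ H₁.Adj u v := fun h' => hd u v h' h
    simp [c, this]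
  refine ⟨c, ?_, e1, e2⟩
  have k1 : ∀ v w, H₁.Adj v w → cd G c v (c₁ s(v, w)) = cd H₁ c₁ v (c₁ s(v, w)) := by
    intro v w hvw
    unfold cd
    congr 1
    ext x
    simp only [Set.mem_ofPred_eq, hG]
    constructor
    · rintro ⟨h | h, h'⟩
      · exact ⟨h, by rw [← e1 _ _ h]; exact h'⟩
      · rw [e2 _ _ h] at h'
        exact absurd h'.symm (hc v w x hvw h)
    · rintro ⟨h, h'⟩
      exact ⟨Or.inl h, by rw [e1 _ _ h]; exact h'⟩
  have k2 : ∀ v w, H₂.Adj v w → cd G c v (c₂ s(v, w)) = cd H₂ c₂ v (c₂ s(v, w)) := by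
    intro v w hvw
    unfold cd
    congr 1
    ext x
    simp only [Set.mem_ofPred_eq, hG]
    constructor
    · rintro ⟨h | h, h'⟩
      · rw [e1 _ _ h] at h'
        exact absurd h' (hc v x w h hvw)
      · exact ⟨h, by rw [← e2 _ _ h]; exact h'⟩
    · rintro ⟨h, h'⟩
      exact ⟨Or.inr h, by rw [e2 _ _ h]; exact h'⟩
  intro u v huv
  rcases (hG u v).1 huv with h | h
  · have a1 := k1 u v h
    have a2 := k1 v u h.symm
    rw [Sym2.eq_swap] at a2
    rw [e1 _ _ h, a1, a2]
    exact h₁ u v h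
  · have a1 := k2 u v h
    have a2 := k2 v u h.symm
    rw [Sym2.eq_swap] at a2
    rw [e2 _ _ h, a1, a2]
    exact h₂ u v h

theorem LI_star [Finite V] {G : SimpleGraph V} {v p q : V} {S : Set V} (hp : p ∈ S) (hq : q ∈ S)
    (hpq : p ≠ q) (ap : G.Adj v p) (aq : G.Adj v q) (j : κ) : LI (stG G v S) (fun _ => j) := by
  have hc : 2 ≤ cd (stG G v S) (fun _ => j) v j := by
    unfold cd
    rw [← Set.ncard_pair hpq]
    apply Set.ncard_le_ncard _ (Set.toFinite _)
    intro x hx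
    rcases hx with rfl | rfl
    · exact ⟨⟨ap, Or.inl ⟨rfl, hp⟩⟩, rfl⟩
    · exact ⟨⟨aq, Or.inl ⟨rfl, hq⟩⟩, rfl⟩
  have hl : ∀ w, w ≠ v → cd (stG G v S) (fun _ => j) w j ≤ 1 := by
    intro w hw
    unfold cd
    rw [← Set.ncard_singleton v]
    apply Set.ncard_le_ncard _ (Set.toFinite _)
    rintro x ⟨⟨_, h⟩, _⟩
    rcases h with h | h
    · exact absurd h.1 hw
    · exact h.1
  intro u w huw
  have hne := huw.ne
  rcases huw.2 with h | h
  · have := hl w (by rintro rfl; exact hne h.1)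
    rw [h.1]
    simp only
    omega
  · have := hl u (by rintro rfl; exact hne h.1.symm)
    rw [h.1]
    simp only
    omega

theorem Dec.union {G H₁ H₂ : SimpleGraph V}
    (hG : ∀ u v, G.Adj u v ↔ H₁.Adj u v ∨ H₂.Adj u v)
    (hd : ∀ u v, H₁.Adj u v → ¬ H₂.Adj u v)
    (h₁ : Dec H₁) (h₂ : Dec H₂) : Dec G := by
  obtain ⟨c₁, hc₁⟩ := h₁
  obtain ⟨c₂, hc₂⟩ := h₂
  obtain ⟨c, hc, _⟩ := glue hG hd (LI_inj hc₁ (fun n => 2 * n) (fun a b h => by grind))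
    (LI_inj hc₂ (fun n => 2 * n + 1) (fun a b h => by grind)) (by intros; omega)
  exact ⟨c, hc⟩

theorem Dec.star [Finite V] {G : SimpleGraph V} {v p q : V} {S : Set V} (hp : p ∈ S) (hq : q ∈ S)
    (hpq : p ≠ q) (ap : G.Adj v p) (aq : G.Adj v q) : Dec (stG G v S) :=
  ⟨_, LI_star hp hq hpq ap aq 0⟩

/-! ### orientations -/

theorem dec_of_orient [Fintype V] (n : ℕ) : ∀ (H : SimpleGraph V) (h : Sym2 V → V),
    H.edgeFinset.card = n → (∀ e ∈ H.edgeFinset, h e ∈ e) →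
    (∀ v, Even (H.edgeFinset.filter (fun e => h e = v)).card) → Dec H := by
  induction n using Nat.strong_induction_on with
  | _ n ih =>
    intro H h hn hv hev
    by_cases hE : H.edgeFinset = ∅
    · refine ⟨fun _ => 0, fun u v huv => ?_⟩
      have : s(u, v) ∈ H.edgeFinset := by simpa using huv
      rw [hE] at this
      simp at this
    obtain ⟨e0, he0⟩ := Finset.nonempty_iff_ne_empty.2 hE
    obtain ⟨v, hv0⟩ : ∃ v, v = h e0 := ⟨_, rfl⟩
    have m0 : e0 ∈ H.edgeFinset.filter (fun e => h e = v) :=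
      Finset.mem_filter.2 ⟨he0, hv0.symm⟩
    have hcard : 1 < (H.edgeFinset.filter (fun e => h e = v)).card := by
      have h1 := hev v
      have h2 := Finset.card_pos.2 ⟨e0, m0⟩
      rcases h1 with ⟨k, hk⟩
      omega
    obtain ⟨e1, m1, hne⟩ := Finset.exists_mem_ne hcard e0
    have q0 := hv e0 he0
    have q1 := hv e1 (Finset.mem_filter.1 m1).1
    have t1 := (Finset.mem_filter.1 m1).2
    rw [t1] at q1
    rw [← hv0] at q0
    obtain ⟨p, rfl⟩ := Sym2.mem_iff_exists.1 q0
    obtain ⟨q, rfl⟩ := Sym2.mem_iff_exists.1 q1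
    have ap : H.Adj v p := by simpa using he0
    have aq : H.Adj v q := by simpa using (Finset.mem_filter.1 m1).1
    have hpq : p ≠ q := by rintro rfl; exact hne rfl
    obtain ⟨H', hH'⟩ : ∃ H', H' = H.deleteEdges {s(v, p), s(v, q)} := ⟨_, rfl⟩
    have hE' : H'.edgeFinset = H.edgeFinset \ {s(v, p), s(v, q)} := by
      ext e; simp [hH']
    have hsub : ({s(v, p), s(v, q)} : Finset (Sym2 V)) ⊆ H.edgeFinset := by
      intro e he
      simp only [Finset.mem_insert, Finset.mem_singleton] at he
      rcases he with rfl | rfl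
      · exact he0
      · exact (Finset.mem_filter.1 m1).1
    have hc2 : ({s(v, p), s(v, q)} : Finset (Sym2 V)).card = 2 := Finset.card_pair hne.symm
    have hD : Dec H' := by
      refine ih (n - 2) ?_ H' h ?_ ?_ ?_
      · have := Finset.card_le_card hsub
        omega
      · rw [hE', Finset.card_sdiff_of_subset hsub, hn, hc2]
      · intro e he
        rw [hE'] at he
        exact hv e (Finset.mem_sdiff.1 he).1
      · intro w
        by_cases hw : w = v
        · have : H'.edgeFinset.filter (fun e => h e = w) =
              (H.edgeFinset.filter (fun e => h e = w)) \ {s(v, p), s(v, q)} := by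
            rw [hE']; ext e; simp only [Finset.mem_filter, Finset.mem_sdiff]; tauto
          rw [this, Finset.card_sdiff_of_subset, hc2]
          · have := hev w
            rw [Nat.even_sub]
            · simp [this]
            · rw [hw]; exact hcard
          · intro e he
            simp only [Finset.mem_insert, Finset.mem_singleton] at he
            rw [hw]
            rcases he with rfl | rfl
            · exact m0
            · exact m1
        · have : H'.edgeFinset.filter (fun e => h e = w) =
              (H.edgeFinset.filter (fun e => h e = w)) := by
            rw [hE']; ext e; simp only [Finset.mem_filter, Finset.mem_sdiff, Finset.mem_insert,
              Finset.mem_singleton]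
            constructor
            · tauto
            · rintro ⟨h1, h2⟩
              refine ⟨⟨h1, ?_⟩, h2⟩
              rintro (rfl | rfl)
              · exact hw (h2.symm.trans hv0.symm)
              · exact hw (h2.symm.trans t1)
          rw [this]
          exact hev w
    refine Dec.union (H₁ := H') (H₂ := stG H v {p, q}) ?_ ?_ hD
      (Dec.star (p := p) (q := q) (by simp) (by simp) hpq ap aq)
    · intro x y
      simp only [hH', SimpleGraph.deleteEdges_adj, stG_adj, Set.mem_insert_iff,
        Set.mem_singleton_iff, Sym2.eq_iff]
      tauto
    · intro x y
      simp only [hH', SimpleGraph.deleteEdges_adj, stG_adj, Set.mem_insert_iff,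
        Set.mem_singleton_iff, Sym2.eq_iff]
      tauto

noncomputable def par [Fintype V] (H : SimpleGraph V) (h : Sym2 V → V) (v : V) : ZMod 2 :=
  ∑ e ∈ H.edgeFinset, if h e = v then 1 else 0

theorem par_flip [Fintype V] (H : SimpleGraph V) (h : Sym2 V → V)
    (hv : ∀ e ∈ H.edgeFinset, h e ∈ e) {u w : V} (huw : H.Adj u w) :
    ∃ h' : Sym2 V → V, (∀ e ∈ H.edgeFinset, h' e ∈ e) ∧
      ∀ v, par H h' v = par H h v + (if u = v then 1 else 0) + (if w = v then 1 else 0) := by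
  have he : s(u, w) ∈ H.edgeFinset := by simpa using huw
  let o := if h s(u, w) = u then w else u
  refine ⟨Function.update h s(u, w) o, ?_, ?_⟩
  · intro e hE
    by_cases h1 : e = s(u, w)
    · subst h1
      simp only [Function.update_self, o]
      split_ifs <;> simp
    · rw [Function.update_of_ne h1]; exact hv e hE
  · intro v
    unfold par
    rw [← Finset.add_sum_erase _ _ he, ← Finset.add_sum_erase _ _ he]
    have : ∑ x ∈ H.edgeFinset.erase s(u, w),
        (if Function.update h s(u, w) o x = v then (1 : ZMod 2) else 0)
        = ∑ x ∈ H.edgeFinset.erase s(u, w), (if h x = v then (1 : ZMod 2) else 0) := by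
      apply Finset.sum_congr rfl
      intro x hx
      rw [Function.update_of_ne (Finset.ne_of_mem_erase hx)]
    rw [this]
    have hmem := hv _ he
    have hne := huw.ne
    have two : (1 : ZMod 2) + 1 = 0 := by decide
    generalize ∑ x ∈ H.edgeFinset.erase s(u, w), (if h x = v then (1 : ZMod 2) else 0) = t
    simp only [Function.update_self, o]
    rw [Sym2.mem_iff] at hmem
    rcases hmem with h1 | h1
    · rw [h1]
      simp only [if_true]
      by_cases a1 : u = v <;> by_cases a2 : w = v <;> simp [a1, a2] <;> grind
    · rw [h1]
      simp only [hne.symm, if_false]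
      by_cases a1 : u = v <;> by_cases a2 : w = v <;> simp [a1, a2] <;> grind

theorem par_walk [Fintype V] (H : SimpleGraph V) {u w : V} (p : H.Walk u w) :
    ∀ (h : Sym2 V → V), (∀ e ∈ H.edgeFinset, h e ∈ e) →
    ∃ h' : Sym2 V → V, (∀ e ∈ H.edgeFinset, h' e ∈ e) ∧
      ∀ v, par H h' v = par H h v + (if u = v then 1 else 0) + (if w = v then 1 else 0) := by
  have two : (1 : ZMod 2) + 1 = 0 := by decide
  induction p with
  | nil =>
    intro h hv
    refine ⟨h, hv, fun v => ?_⟩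
    split_ifs <;> grind
  | cons hab p ih =>
    intro h hv
    obtain ⟨h1, v1, e1⟩ := par_flip H h hv hab
    obtain ⟨h2, v2, e2⟩ := ih h1 v1
    refine ⟨h2, v2, fun v => ?_⟩
    rw [e2, e1]
    split_ifs <;> grind

theorem par_eq [Fintype V] (H : SimpleGraph V) (h : Sym2 V → V) (v : V) :
    par H h v = 0 ↔ Even (H.edgeFinset.filter (fun e => h e = v)).card := by
  unfold par
  rw [Finset.sum_boole, ZMod.natCast_eq_zero_iff_even]

theorem dec_of_even [Fintype V] (H : SimpleGraph V) (r : V)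
    (hr : ∀ u v, H.Adj u v → H.Reachable r u) (hev : Even H.edgeSet.ncard) : Dec H := by
  have hcard : H.edgeSet.ncard = H.edgeFinset.card := by
    rw [← SimpleGraph.coe_edgeFinset, Set.ncard_coe_finset]
  rw [hcard] at hev
  have hS : ∀ S : Finset V, r ∉ S → ∃ h : Sym2 V → V, (∀ e ∈ H.edgeFinset, h e ∈ e) ∧
      ∀ v ∈ S, par H h v = 0 := by
    intro S
    induction S using Finset.induction_on with
    | empty =>
      intro _
      refine ⟨fun e => e.out.1, fun e _ => Sym2.out_fst_mem e, by simp⟩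
    | insert a S ha ih =>
      intro hrS
      rw [Finset.mem_insert, not_or] at hrS
      obtain ⟨h, hv, h0⟩ := ih hrS.2
      by_cases hp : par H h a = 0
      · refine ⟨h, hv, fun v hvS => ?_⟩
        rcases Finset.mem_insert.1 hvS with rfl | h'
        · exact hp
        · exact h0 v h'
      · have hadj : ∃ w, H.Adj a w := by
          by_contra hno
          push Not at hno
          apply hp
          apply Finset.sum_eq_zero
          intro e he
          rw [if_neg]
          intro hea
          have := hv e he
          rw [hea] at this
          obtain ⟨w, rfl⟩ := Sym2.mem_iff_exists.1 this
          exact hno w (by simpa using he)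
        obtain ⟨w, hw⟩ := hadj
        obtain ⟨p⟩ := (hr a w hw).symm
        obtain ⟨h', hv', e'⟩ := par_walk H p h hv
        refine ⟨h', hv', fun v hvS => ?_⟩
        have hrv : r ≠ v := by
          rintro rfl
          rcases Finset.mem_insert.1 hvS with h1 | h1
          · exact hrS.1 h1
          · exact hrS.2 h1
        rw [e', if_neg hrv]
        rcases Finset.mem_insert.1 hvS with rfl | h1
        · have : par H h v = 1 := by
            generalize par H h v = t at *
            revert hp; revert t; decide
          rw [this]; simp; decide
        · rw [h0 v h1, if_neg]
          · simp
          · rintro rfl; exact ha h1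
  obtain ⟨h, hv, h0⟩ := hS (Finset.univ.erase r) (by simp)
  refine dec_of_orient _ H h rfl hv ?_
  have hne : ∀ v, v ≠ r → par H h v = 0 := fun v hvr => h0 v (by simp [hvr])
  intro v
  rw [← par_eq]
  by_cases hvr : v = r
  · subst hvr
    have : ∑ v, par H h v = 0 := by
      unfold par
      rw [Finset.sum_comm]
      simp only [Finset.sum_ite_eq, Finset.mem_univ, if_true, Finset.sum_const]
      rw [nsmul_eq_mul, mul_one, ZMod.natCast_eq_zero_iff_even]
      exact hev
    rw [Finset.sum_eq_single v (fun b _ hb => hne b hb) (by simp)] at this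
    exact this
  · exact hne v hvr

noncomputable def ec (G : SimpleGraph V) (S : Set V) : ℕ := (ind G S).edgeSet.ncard

theorem ec_ins [Finite V] (G : SimpleGraph V) {S : Set V} {v : V} (hv : v ∉ S) (T : Finset V)
    (hT : ∀ w, w ∈ T ↔ w ∈ S ∧ G.Adj v w) : ec G (insert v S) = ec G S + T.card := by
  unfold ec
  have h : (ind G (insert v S)).edgeSet = (ind G S).edgeSet ∪ (fun w => s(v, w)) '' (T : Set V) := by
    ext e
    induction e using Sym2.ind with
    | _ x y =>
      simp only [SimpleGraph.mem_edgeSet, ind_adj, Set.mem_union, Set.mem_image, Finset.mem_coe, hT,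
        Set.mem_insert_iff, Sym2.eq_iff]
      constructor
      · rintro ⟨h, rfl | h1, rfl | h2⟩
        · exact absurd h (G.loopless.irrefl _)
        · exact Or.inr ⟨y, ⟨h2, h⟩, Or.inl ⟨rfl, rfl⟩⟩
        · exact Or.inr ⟨x, ⟨h1, h.symm⟩, Or.inr ⟨rfl, rfl⟩⟩
        · exact Or.inl ⟨h, h1, h2⟩
      · rintro (⟨h, h1, h2⟩ | ⟨w, ⟨h1, h2⟩, ⟨rfl, rfl⟩ | ⟨rfl, rfl⟩⟩)
        · exact ⟨h, Or.inr h1, Or.inr h2⟩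
        · exact ⟨h2, Or.inl rfl, Or.inr h1⟩
        · exact ⟨h2.symm, Or.inr h1, Or.inl rfl⟩
  rw [h, Set.ncard_union_eq _ (Set.toFinite _) (Set.toFinite _), Set.ncard_image_of_injective,
    Set.ncard_coe_finset]
  · intro x y hxy
    simp only [Sym2.eq_iff] at hxy
    grind
  · rw [Set.disjoint_left]
    rintro e he ⟨w, hw, rfl⟩
    simp only [SimpleGraph.mem_edgeSet, ind_adj] at he
    exact hv he.2.1

theorem ec_union [Finite V] (G : SimpleGraph V) {A B : Set V} (hd : ∀ x ∈ A, x ∉ B)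
    (hn : ∀ x ∈ A, ∀ y ∈ B, ¬ G.Adj x y) : ec G (A ∪ B) = ec G A + ec G B := by
  unfold ec
  rw [← Set.ncard_union_eq _ (Set.toFinite _) (Set.toFinite _)]
  · congr 1
    ext e
    induction e using Sym2.ind with
    | _ x y =>
      simp only [SimpleGraph.mem_edgeSet, ind_adj, Set.mem_union]
      have h1 := hn x
      have h2 := hn y
      have h3 := G.adj_comm x y
      constructor
      · rintro ⟨h, a | a, b | b⟩
        · exact Or.inl ⟨h, a, b⟩
        · exact absurd h (h1 a y b)
        · exact absurd h.symm (h2 b x a)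
        · exact Or.inr ⟨h, a, b⟩
      · tauto
  · rw [Set.disjoint_left]
    intro e
    induction e using Sym2.ind with
    | _ x y =>
      simp only [SimpleGraph.mem_edgeSet, ind_adj]
      intro h h'
      exact hd x h.2.1 h'.2.1

def RC (G : SimpleGraph V) (S : Set V) (r : V) : Prop := ∀ v ∈ S, (ind G S).Reachable r v

theorem RC.dec [Fintype V] {G : SimpleGraph V} {S : Set V} {r : V} (h : RC G S r)
    (he : Even (ec G S)) : Dec (ind G S) :=
  dec_of_even _ r (fun u _ huv => h u huv.2.1) he

theorem reach_ind {G : SimpleGraph V} {r : V} (P : V → Prop) (h0 : P r)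
    (hs : ∀ u v, G.Reachable r u → P u → G.Adj u v → P v) : ∀ v, G.Reachable r v → P v := by
  intro v hv
  rw [SimpleGraph.reachable_iff_reflTransGen] at hv
  induction hv with
  | refl => exact h0
  | tail h1 h2 ih =>
    exact hs _ _ ((SimpleGraph.reachable_iff_reflTransGen _ _).2 h1) ih h2

theorem ind_mono {G : SimpleGraph V} {S T : Set V} (h : S ⊆ T) : ind G S ≤ ind G T :=
  fun _ _ hx => ⟨hx.1, h hx.2.1, h hx.2.2⟩

theorem RC_comp (G : SimpleGraph V) (T : Set V) (r : V) :
    RC G {v | (ind G T).Reachable r v} r := by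
  intro v hv
  refine reach_ind (G := ind G T) (fun v => (ind G {v | (ind G T).Reachable r v}).Reachable r v)
    (SimpleGraph.Reachable.refl _) ?_ v hv
  intro u w hu hP huw
  refine hP.trans (SimpleGraph.Adj.reachable ?_)
  exact ⟨huw.1, hu, hu.trans huw.reachable⟩

theorem comp_sub {G : SimpleGraph V} {T : Set V} {r : V} (hr : r ∈ T) :
    ∀ v, (ind G T).Reachable r v → v ∈ T :=
  reach_ind _ hr (fun _ _ _ _ h => h.2.2)

theorem RC.insert {G : SimpleGraph V} {S : Set V} {r v p : V} (h : RC G S r) (hp : p ∈ S)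
    (ha : G.Adj v p) : RC G (insert v S) r := by
  have key : ∀ w ∈ S, (ind G (Insert.insert v S)).Reachable r w :=
    fun w hw => (h w hw).mono (ind_mono (Set.subset_insert _ _))
  intro w hw
  rcases Set.mem_insert_iff.1 hw with rfl | hw
  · refine (key p hp).trans (SimpleGraph.Adj.reachable ?_)
    exact ⟨ha.symm, Or.inr hp, Or.inl rfl⟩
  · exact key w hw

theorem RC.simp {G : SimpleGraph V} {S : Set V} {r p : V} (h : RC G S r) (hrp : r ≠ p)
    (hn : ∀ x ∈ S, ∀ y ∈ S, G.Adj p x → G.Adj p y → x = y ∨ G.Adj x y) :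
    RC G (S \ {p}) r := by
  have key : ∀ v, (ind G S).Reachable r v →
      ((v = p → ∀ f ∈ S, G.Adj p f → (ind G (S \ {p})).Reachable r f) ∧
       (v ≠ p → (ind G (S \ {p})).Reachable r v)) := by
    apply reach_ind
    · exact ⟨fun h => absurd h hrp, fun _ => SimpleGraph.Reachable.refl _⟩
    · rintro u w hu ⟨h1, h2⟩ huw
      constructor
      · rintro rfl f hf haf
        have hup : u ≠ w := huw.ne
        rcases hn u huw.2.1 f hf huw.1.symm haf with rfl | h3
        · exact h2 hup
        · refine (h2 hup).trans (SimpleGraph.Adj.reachable ?_)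
          exact ⟨h3, ⟨huw.2.1, hup⟩, ⟨hf, haf.ne.symm⟩⟩
      · intro hwp
        by_cases hup : u = p
        · subst hup
          exact h1 rfl w huw.2.2 huw.1
        · refine (h2 hup).trans (SimpleGraph.Adj.reachable ?_)
          exact ⟨huw.1, ⟨huw.2.1, hup⟩, ⟨huw.2.2, hwp⟩⟩
  intro v hv
  exact (key v (h v hv.1)).2 hv.2

structure Ctx (G : SimpleGraph V) : Prop where
  conn : G.Connected
  claw : ∀ v a b c, a ≠ b → a ≠ c → b ≠ c → G.Adj v a → G.Adj v b → G.Adj v c →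
    G.Adj a b ∨ G.Adj a c ∨ G.Adj b c
  deg : ∀ v, (G.neighborSet v).ncard ≤ 3
  dec : Dec G
  ncol : ¬ Col G
  min : ∀ S : Set V, Dec (ind G S) → (∃ u v, G.Adj u v ∧ u ∉ S) → Col (ind G S)

theorem exit {G : SimpleGraph V} (hc : G.Connected) (K : Set V) {k0 : V} (hk : k0 ∈ K) :
    ∀ v, v ∉ K → ∃ r, r ∉ K ∧ (∃ k ∈ K, G.Adj k r) ∧ (ind G Kᶜ).Reachable r v := by
  intro v
  refine reach_ind (G := G) (r := k0) (fun v => v ∉ K → ∃ r, r ∉ K ∧ (∃ k ∈ K, G.Adj k r) ∧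
    (ind G Kᶜ).Reachable r v) (fun h => absurd hk h) ?_ v (hc.preconnected k0 v)
  intro u w _ hP huw hw
  by_cases hu : u ∈ K
  · exact ⟨w, hw, ⟨u, hu, huw⟩, SimpleGraph.Reachable.refl _⟩
  · obtain ⟨r, h1, h2, h3⟩ := hP hu
    exact ⟨r, h1, h2, h3.trans (SimpleGraph.Adj.reachable ⟨huw, hu, hw⟩)⟩

theorem RC_univ {G : SimpleGraph V} (hc : G.Connected) (r : V) : RC G Set.univ r := by
  intro v _
  exact (hc.preconnected r v).mono (fun _ _ h => ⟨h, trivial, trivial⟩)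

theorem ind_univ (G : SimpleGraph V) : ind G Set.univ = G := by
  ext u v; simp [ind_adj]

/-! transfer of minimality -/

theorem LI_iso {W : Type*} {G : SimpleGraph V} (f : V ≃ W) (c : Sym2 W → κ) :
    LI (G.map f.toEmbedding) c ↔ LI G (fun e => c (e.map f)) := by
  have ha : ∀ x y, (G.map f.toEmbedding).Adj (f x) (f y) ↔ G.Adj x y := by
    intro x y
    exact SimpleGraph.map_adj_apply
  have hcd : ∀ x i, cd (G.map f.toEmbedding) c (f x) i = cd G (fun e => c (e.map f)) x i := by
    intro x i
    unfold cd
    rw [← Set.ncard_image_of_injective _ f.injective]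
    congr 1
    ext w
    simp only [Set.mem_ofPred_eq, Set.mem_image, Sym2.map_mk]
    constructor
    · rintro ⟨h1, h2⟩
      obtain ⟨y, rfl⟩ := f.surjective w
      exact ⟨y, ⟨(ha _ _).1 h1, h2⟩, rfl⟩
    · rintro ⟨y, ⟨h1, h2⟩, rfl⟩
      exact ⟨(ha _ _).2 h1, h2⟩
  constructor
  · intro h u v huv
    have := h (f u) (f v) ((ha _ _).2 huv)
    rw [hcd, hcd] at this
    exact this
  · intro h u v huv
    obtain ⟨x, rfl⟩ := f.surjective u
    obtain ⟨y, rfl⟩ := f.surjective v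
    rw [hcd, hcd]
    exact h x y ((ha _ _).1 huv)

theorem mkCtx [Fintype V] (G : SimpleGraph V)
    (hconn : G.Connected) (hdec : Decomposable G) (hclaw : ClawFree G)
    (hdeg : MaxDegreeLE G 3) (hG : ¬ HasLIEC G 3)
    (hmin : ∀ (W : Type) [Fintype W] (H : SimpleGraph W),
      Decomposable H → ClawFree H → MaxDegreeLE H 3 →
      H.edgeSet.ncard < G.edgeSet.ncard → HasLIEC H 3) : Ctx G := by
  have hcl : ∀ v a b c, a ≠ b → a ≠ c → b ≠ c → G.Adj v a → G.Adj v b → G.Adj v c →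
      G.Adj a b ∨ G.Adj a c ∨ G.Adj b c := by
    intro v a b c h1 h2 h3 h4 h5 h6
    by_contra hno
    simp only [not_or] at hno
    exact hclaw ⟨v, a, b, c, h1, h2, h3, h4, h5, h6, hno.1, hno.2.1, hno.2.2⟩
  refine ⟨hconn, hcl, hdeg, dec_of_decomposable hdec, fun h => hG ((hasLIEC_iff _ _).2 h), ?_⟩
  rintro S ⟨c, hc⟩ ⟨u, v, huv, hu⟩
  let f := Fintype.equivFin V
  have ha : ∀ x y, ((ind G S).map f.toEmbedding).Adj (f x) (f y) ↔ (ind G S).Adj x y := by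
    intro x y
    exact SimpleGraph.map_adj_apply
  have hsymm : ∀ e : Sym2 V, (e.map f).map f.symm = e := by
    intro e
    rw [Sym2.map_map]; simp
  have := hmin (Fin (Fintype.card V)) ((ind G S).map f.toEmbedding) ?_ ?_ ?_ ?_
  · obtain ⟨c', hc'⟩ := (hasLIEC_iff _ _).1 this
    exact ⟨_, (LI_iso f c').1 hc'⟩
  · refine decomposable_of_dec ⟨fun e => c (e.map f.symm), (LI_iso f _).2 ?_⟩
    simpa only [hsymm] using hc
  · rintro ⟨v, a, b, c, h⟩
    obtain ⟨v, rfl⟩ := f.surjective v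
    obtain ⟨a, rfl⟩ := f.surjective a
    obtain ⟨b, rfl⟩ := f.surjective b
    obtain ⟨c, rfl⟩ := f.surjective c
    simp only [ha, ind_adj, f.injective.ne_iff] at h
    obtain ⟨h1, h2, h3, h4, h5, h6, h7, h8, h9⟩ := h
    have := hcl v a b c h1 h2 h3 h4.1 h5.1 h6.1
    tauto
  · intro v
    obtain ⟨v, rfl⟩ := f.surjective v
    have : ((ind G S).map f.toEmbedding).neighborSet (f v) ⊆ f '' G.neighborSet v := by
      intro w hw
      obtain ⟨w, rfl⟩ := f.surjective w
      exact ⟨w, ((ha _ _).1 hw).1, rfl⟩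
    refine (Set.ncard_le_ncard this (Set.toFinite _)).trans ?_
    rw [Set.ncard_image_of_injective _ f.injective]
    exact hdeg v
  · have h1 : ((ind G S).map f.toEmbedding).edgeSet = (Sym2.map f) '' (ind G S).edgeSet := by
      exact SimpleGraph.edgeSet_map _ _
    rw [h1, Set.ncard_image_of_injective _ (Sym2.map.injective f.injective)]
    apply Set.ncard_lt_ncard _ (Set.toFinite _)
    refine Set.ssubset_iff_of_subset ?_ |>.2 ⟨s(u, v), huv, fun h => hu h.2.1⟩
    intro e
    induction e using Sym2.ind with
    | _ x y => exact fun h => h.1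


theorem nb2 [Finite V] {G : SimpleGraph V} {a b c : V} (h : (G.neighborSet a).ncard = 2)
    (hb : G.Adj a b) (hc : G.Adj a c) (hbc : b ≠ c) : ∀ w, G.Adj a w ↔ w = b ∨ w = c := by
  have h1 : ({b, c} : Set V) = G.neighborSet a := by
    apply Set.eq_of_subset_of_ncard_le _ _ (Set.toFinite _)
    · rintro x (rfl | rfl)
      · exact hb
      · exact hc
    · rw [h, Set.ncard_pair hbc]
  intro w
  rw [← SimpleGraph.mem_neighborSet, ← h1]
  simp

theorem nb_le [Finite V] {G : SimpleGraph V} {a b : V} (h : (G.neighborSet a).ncard ≤ 3)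
    (hb : G.Adj a b) : ∃ p q, ∀ w, G.Adj a w → w = b ∨ w = p ∨ w = q := by
  have h1 : (G.neighborSet a \ {b}).ncard ≤ 2 := by
    have := Set.ncard_sdiff_singleton_add_one (s := G.neighborSet a) (a := b) hb (Set.toFinite _)
    omega
  by_cases h2 : ∃ p, p ∈ G.neighborSet a \ {b}
  · obtain ⟨p, hp⟩ := h2
    have h3 := Set.ncard_sdiff_singleton_add_one hp (Set.toFinite _)
    by_cases h4 : ∃ q, q ∈ (G.neighborSet a \ {b}) \ {p}
    · obtain ⟨q, hq⟩ := h4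
      refine ⟨p, q, fun w hw => ?_⟩
      by_contra hno
      simp only [not_or] at hno
      have h5 : ({w, q} : Set V) ⊆ (G.neighborSet a \ {b}) \ {p} := by
        rintro x (rfl | rfl)
        · exact ⟨⟨hw, hno.1⟩, hno.2.1⟩
        · exact hq
      have := Set.ncard_le_ncard h5 (Set.toFinite _)
      rw [Set.ncard_pair hno.2.2] at this
      omega
    · refine ⟨p, p, fun w hw => ?_⟩
      by_contra hno
      simp only [not_or] at hno
      exact h4 ⟨w, ⟨⟨hw, hno.1⟩, hno.2.1⟩⟩
  · refine ⟨b, b, fun w hw => ?_⟩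
    by_contra hno
    exact h2 ⟨w, hw, fun h => hno (Or.inl h)⟩

theorem nb_le2 [Finite V] {G : SimpleGraph V} {a b c : V} (h : (G.neighborSet a).ncard ≤ 3)
    (hb : G.Adj a b) (hc : G.Adj a c) (hbc : b ≠ c) :
    ∃ p, ∀ w, G.Adj a w → w = b ∨ w = c ∨ w = p := by
  obtain ⟨p, q, hpq⟩ := nb_le h hb
  rcases hpq c hc with h1 | h1 | h1
  · exact absurd h1.symm hbc
  · subst h1; exact ⟨q, hpq⟩
  · subst h1; exact ⟨p, fun w hw => by have := hpq w hw; tauto⟩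

theorem nb_le3 [Finite V] {G : SimpleGraph V} {a b c d : V} (h : (G.neighborSet a).ncard ≤ 3)
    (hb : G.Adj a b) (hc : G.Adj a c) (hd : G.Adj a d) (hbc : b ≠ c) (hbd : b ≠ d) (hcd : c ≠ d) :
    ∀ w, G.Adj a w ↔ w = b ∨ w = c ∨ w = d := by
  obtain ⟨p, hp⟩ := nb_le2 h hb hc hbc
  have : d = p := by
    rcases hp d hd with h | h | h
    · exact absurd h.symm hbd
    · exact absurd h.symm hcd
    · exact h
  subst this
  intro w
  refine ⟨hp w, ?_⟩
  rintro (rfl | rfl | rfl) <;> assumption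

theorem nb3 [Finite V] {G : SimpleGraph V} {a b c : V} (h : (G.neighborSet a).ncard = 3)
    (hb : G.Adj a b) (hc : G.Adj a c) (hbc : b ≠ c) :
    ∃ d, d ≠ b ∧ d ≠ c ∧ ∀ w, G.Adj a w ↔ w = b ∨ w = c ∨ w = d := by
  by_contra hno
  have h1 : G.neighborSet a ⊆ {b, c} := by
    intro d hd
    by_contra hd'
    simp only [Set.mem_insert_iff, Set.mem_singleton_iff, not_or] at hd'
    exact hno ⟨d, hd'.1, hd'.2, nb_le3 h.le hb hc hd hbc (Ne.symm hd'.1) (Ne.symm hd'.2)⟩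
  have := Set.ncard_le_ncard h1 (Set.toFinite _)
  rw [Set.ncard_pair hbc] at this
  omega

theorem cd1 {H : SimpleGraph V} {c : Sym2 V → κ} {v x : V} (h : ∀ w, H.Adj v w ↔ w = x) (i : κ) :
    cd H c v i = if c s(v, x) = i then 1 else 0 := by
  unfold cd
  split_ifs with h1
  · rw [← Set.ncard_singleton x]
    congr 1; ext w; simp only [Set.mem_ofPred_eq, h, Set.mem_singleton_iff]
    constructor
    · tauto
    · rintro rfl; tauto
  · convert Set.ncard_empty V
    ext w
    simp only [Set.mem_ofPred_eq, h, Set.mem_empty_iff_false, iff_false]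
    rintro ⟨rfl, h2⟩; exact h1 h2

theorem cd_split [Finite V] {H : SimpleGraph V} {c : Sym2 V → κ} {v x : V} (P : V → Prop)
    (hx : ¬ P x) (h : ∀ w, H.Adj v w ↔ w = x ∨ P w) (i : κ) :
    cd H c v i = (if c s(v, x) = i then 1 else 0) + {w | P w ∧ c s(v, w) = i}.ncard := by
  unfold cd
  split_ifs with h1
  · rw [add_comm, ← Set.ncard_insert_of_notMem (a := x) (by simp [hx]) (Set.toFinite _)]
    congr 1; ext w; simp only [Set.mem_ofPred_eq, h, Set.mem_insert_iff]
    constructor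
    · tauto
    · rintro (rfl | h) <;> tauto
  · rw [zero_add]
    congr 1; ext w; simp only [Set.mem_ofPred_eq, h]
    constructor
    · rintro ⟨rfl | h3, h2⟩ <;> tauto
    · tauto

theorem nc1 [Finite V] {c : Sym2 V → κ} {v x : V} (i : κ) :
    {w | (w = x) ∧ c s(v, w) = i}.ncard = if c s(v, x) = i then 1 else 0 := by
  split_ifs with h1
  · rw [← Set.ncard_singleton x]
    congr 1; ext w; simp only [Set.mem_ofPred_eq, Set.mem_singleton_iff]
    constructor
    · tauto
    · rintro rfl; tauto
  · convert Set.ncard_empty V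
    ext w
    simp only [Set.mem_ofPred_eq, Set.mem_empty_iff_false, iff_false]
    rintro ⟨rfl, h2⟩; exact h1 h2

theorem cd2 [Finite V] {H : SimpleGraph V} {c : Sym2 V → κ} {v x y : V} (hxy : x ≠ y)
    (h : ∀ w, H.Adj v w ↔ w = x ∨ w = y) (i : κ) :
    cd H c v i = (if c s(v, x) = i then 1 else 0) + (if c s(v, y) = i then 1 else 0) := by
  rw [cd_split (fun w => w = y) hxy h, nc1]

theorem cd3 [Finite V] {H : SimpleGraph V} {c : Sym2 V → κ} {v x y z : V} (hxy : x ≠ y)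
    (hxz : x ≠ z) (hyz : y ≠ z)
    (h : ∀ w, H.Adj v w ↔ w = x ∨ w = y ∨ w = z) (i : κ) :
    cd H c v i = (if c s(v, x) = i then 1 else 0) + ((if c s(v, y) = i then 1 else 0) +
      (if c s(v, z) = i then 1 else 0)) := by
  rw [cd_split (fun w => w = y ∨ w = z) (by simp [hxy, hxz]) h]
  congr 1
  have := cd2 (H := stG ⊤ v {y, z}) (c := c) (v := v) hyz
  by_cases hy : v = y
  · subst hy
    exact absurd ((h v).2 (by simp)) (H.loopless.irrefl _)
  by_cases hz : v = z
  · subst hz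
    exact absurd ((h v).2 (by simp)) (H.loopless.irrefl _)
  have ha : ∀ w, (stG ⊤ v {y, z}).Adj v w ↔ w = y ∨ w = z := by
    intro w
    simp only [stG_adj, SimpleGraph.top_adj, Set.mem_insert_iff, Set.mem_singleton_iff]
    constructor
    · rintro ⟨h1, ⟨_, h2⟩ | ⟨h2, h3⟩⟩
      · exact h2
      · exact absurd h2.symm h1
    · intro h1
      refine ⟨?_, Or.inl ⟨trivial, h1⟩⟩
      rintro rfl; tauto
  rw [← this ha i]
  unfold cd
  simp only [ha]

/-- a leaf edge shares its color with the other edge at its degree two endpoint -/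
theorem leaf_color [Finite V] {H : SimpleGraph V} {c : Sym2 V → κ} {u v x : V} (hc : LI H c)
    (hux : u ≠ x) (hu : ∀ w, H.Adj u w ↔ w = v) (hv : ∀ w, H.Adj v w ↔ w = u ∨ w = x) :
    c s(v, x) = c s(u, v) := by
  have h := hc u v ((hu v).2 rfl)
  rw [cd1 hu, cd2 hux hv] at h
  by_contra hne
  rw [Sym2.eq_swap (a := v) (b := u)] at h
  simp [hne] at h

theorem fin3_avoid : ∀ i j : Fin 3, ∃ k, k ≠ i ∧ k ≠ j := by decide

theorem fin3_dist : ∀ x y z : Fin 3, (¬ ∃ j, j ≠ x ∧ j ≠ y ∧ j ≠ z) → x ≠ y ∧ x ≠ z ∧ y ≠ z := by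
  decide

theorem starA [Finite V] {G : SimpleGraph V} (h : Ctx G) {a b c : V} (ab : G.Adj a b)
    (ac : G.Adj a c) (bc : G.Adj b c) (S : Set V) (haS : a ∉ S)
    (hS : ∀ u v, G.Adj u v → u ≠ a → v ≠ a → u ∈ S ∧ v ∈ S)
    (hn : ∀ w ∈ S, G.Adj a w → w = b ∨ w = c) (hD : Dec (ind G S)) : False := by
  obtain ⟨c1, hc1⟩ := h.min S hD ⟨a, b, ab, haS⟩
  obtain ⟨b', hb⟩ := nb_le2 (h.deg b) ab.symm bc ac.ne
  obtain ⟨c', hc⟩ := nb_le2 (h.deg c) ac.symm bc.symm ab.ne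
  have hbS := (hS b c bc ab.ne.symm ac.ne.symm).1
  have hcS := (hS b c bc ab.ne.symm ac.ne.symm).2
  by_cases hj : ∃ j, j ≠ c1 s(b, c) ∧ j ≠ c1 s(b, b') ∧ j ≠ c1 s(c, c')
  · obtain ⟨j, h1, h2, h3⟩ := hj
    obtain ⟨C, hC, _⟩ := glue (G := G) (H₁ := ind G S) (H₂ := stG G a Set.univ)
      (by
        intro u v
        simp only [ind_adj, stG_adj, Set.mem_univ, and_true]
        constructor
        · intro huv
          have := hS u v huv
          tauto
        · tauto)
      (by
        intro u v h1 h2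
        simp only [ind_adj, stG_adj, Set.mem_univ, and_true] at h1 h2
        rcases h2.2 with rfl | rfl
        · exact haS h1.2.1
        · exact haS h1.2.2) hc1
      (LI_star (p := b) (q := c) (by simp) (by simp) bc.ne ab ac j)
      (by
        intro v w w' hv1 hv2
        simp only [ind_adj, stG_adj, Set.mem_univ, and_true] at hv1 hv2
        have hva : v ≠ a := by rintro rfl; exact haS hv1.2.1
        have hw' : w' = a := by tauto
        subst hw'
        have hwa : w ≠ w' := by rintro rfl; exact haS hv1.2.2
        rcases hn v hv1.2.1 hv2.1.symm with rfl | rfl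
        · rcases hb w hv1.1 with rfl | rfl | rfl
          · exact absurd rfl hwa
          · exact h1.symm
          · exact h2.symm
        · rcases hc w hv1.1 with rfl | rfl | rfl
          · exact absurd rfl hwa
          · rw [Sym2.eq_swap]; exact h1.symm
          · exact h3.symm)
    exact h.ncol ⟨C, hC⟩
  · obtain ⟨h1, h2, h3⟩ := fin3_dist _ _ _ hj
    have := hc1 b c ⟨bc, hbS, hcS⟩
    apply this
    unfold cd
    have e1 : {w | (ind G S).Adj b w ∧ c1 s(b, w) = c1 s(b, c)} = {c} := by
      ext w
      simp only [Set.mem_ofPred_eq, Set.mem_singleton_iff, ind_adj]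
      constructor
      · rintro ⟨⟨h4, _, h5⟩, h6⟩
        rcases hb w h4 with rfl | rfl | rfl
        · exact absurd h5 haS
        · rfl
        · exact absurd h6.symm h1
      · rintro rfl; exact ⟨⟨bc, hbS, hcS⟩, rfl⟩
    have e2 : {w | (ind G S).Adj c w ∧ c1 s(c, w) = c1 s(b, c)} = {b} := by
      ext w
      simp only [Set.mem_ofPred_eq, Set.mem_singleton_iff, ind_adj]
      constructor
      · rintro ⟨⟨h4, _, h5⟩, h6⟩
        rcases hc w h4 with rfl | rfl | rfl
        · exact absurd h5 haS
        · rfl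
        · exact absurd h6.symm h2
      · rintro rfl; exact ⟨⟨bc.symm, hcS, hbS⟩, by rw [Sym2.eq_swap]⟩
    rw [e1, e2, Set.ncard_singleton, Set.ncard_singleton]

/-- if `a` has degree two with adjacent neighbours, the number of edges is odd -/
theorem odd_of_tri2 [Fintype V] {G : SimpleGraph V} (h : Ctx G) {a b c : V} (bc : G.Adj b c)
    (na : ∀ w, G.Adj a w ↔ w = b ∨ w = c) : ¬ Even (ec G Set.univ) := by
  intro he
  have ab : G.Adj a b := (na b).2 (by simp)
  have ac : G.Adj a c := (na c).2 (by simp)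
  refine starA h ab ac bc (Set.univ \ {a}) (by simp) (by simp; tauto)
    (fun w _ hw => (na w).1 hw) ?_
  have hr : RC G (Set.univ \ {a}) b := by
    apply (RC_univ h.conn b).simp ab.ne.symm
    intro x _ y _ hx hy
    rw [na] at hx hy
    have := bc.symm
    rcases hx with rfl | rfl <;> rcases hy with rfl | rfl <;> tauto
  apply hr.dec
  have h1 := ec_ins G (S := Set.univ \ {a}) (v := a) (by simp) {b, c} (by
    intro w
    rw [na]
    have := ab.ne
    have := ac.ne
    simp only [Finset.mem_insert, Finset.mem_singleton, Set.mem_sdiff, Set.mem_univ,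
      Set.mem_singleton_iff, true_and]
    constructor
    · rintro (rfl | rfl)
      · exact ⟨ab.ne.symm, Or.inl rfl⟩
      · exact ⟨ac.ne.symm, Or.inr rfl⟩
    · tauto)
  rw [Finset.card_pair bc.ne] at h1
  have h2 : insert a (Set.univ \ {a}) = (Set.univ : Set V) := by
    ext x; simp
  rw [h2] at h1
  rw [h1] at he
  simpa [Nat.even_add] using he


structure Tri (G : SimpleGraph V) (a b c b' c' : V) (X Y : Set V) : Prop where
  na : ∀ w, G.Adj a w ↔ w = b ∨ w = c
  nb : ∀ w, G.Adj b w ↔ w = a ∨ w = c ∨ w = b'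
  nc : ∀ w, G.Adj c w ↔ w = a ∨ w = b ∨ w = c'
  dab : a ≠ b
  dac : a ≠ c
  dbc : b ≠ c
  aX : a ∉ X
  bX : b ∉ X
  cX : c ∉ X
  aY : a ∉ Y
  bY : b ∉ Y
  cY : c ∉ Y
  b'X : b' ∈ X
  c'Y : c' ∈ Y
  disj : ∀ v ∈ X, v ∉ Y
  cov : ∀ v, v = a ∨ v = b ∨ v = c ∨ v ∈ X ∨ v ∈ Y
  clX : ∀ u v, u ∈ X → G.Adj u v → v ∉ X → u = b' ∧ v = b
  clY : ∀ u v, u ∈ Y → G.Adj u v → v ∉ Y → u = c' ∧ v = c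
  rX : RC G X b'
  rY : RC G Y c'

theorem Tri.symm {G : SimpleGraph V} {a b c b' c' : V} {X Y : Set V} (t : Tri G a b c b' c' X Y) :
    Tri G a c b c' b' Y X where
  na := fun w => by rw [t.na]; tauto
  nb := t.nc
  nc := t.nb
  dab := t.dac
  dac := t.dab
  dbc := t.dbc.symm
  aX := t.aY
  bX := t.cY
  cX := t.bY
  aY := t.aX
  bY := t.cX
  cY := t.bX
  b'X := t.c'Y
  c'Y := t.b'X
  disj := fun v h h' => t.disj v h' h
  cov := fun v => by have := t.cov v; tauto
  clX := t.clY
  clY := t.clX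
  rX := t.rY
  rY := t.rX

theorem Tri.ecX [Finite V] {G : SimpleGraph V} {a b c b' c' : V} {X Y : Set V}
    (t : Tri G a b c b' c' X Y) : ec G (insert b X) = ec G X + 1 := by
  obtain ⟨na, nb, nc, dab, dac, dbc, aX, bX, cX, aY, bY, cY, b'X, c'Y, disj, cov, clX, clY, _, _⟩ := t
  rw [ec_ins G bX {b'} (by intro w; simp only [Finset.mem_singleton]; grind)]
  simp

theorem Tri.ecUniv [Finite V] {G : SimpleGraph V} {a b c b' c' : V} {X Y : Set V}
    (t : Tri G a b c b' c' X Y) : ec G Set.univ = ec G X + ec G Y + 5 := by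
  obtain ⟨na, nb, nc, dab, dac, dbc, aX, bX, cX, aY, bY, cY, b'X, c'Y, disj, cov, clX, clY, _, _⟩ := t
  have hu : (Set.univ : Set V) = insert a (insert b (insert c (X ∪ Y))) := by
    ext v; simp only [Set.mem_univ, Set.mem_insert_iff, Set.mem_union, true_iff]; exact cov v
  have d1 : b' ≠ c := by rintro rfl; exact cX b'X
  rw [hu, ec_ins G (v := a) (by simp; tauto) {b, c} (by
      intro w; simp only [Finset.mem_singleton, Finset.mem_insert, Set.mem_insert_iff,
        Set.mem_union]; grind),
    ec_ins G (v := b) (by simp; tauto) {c, b'} (by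
      intro w; simp only [Finset.mem_singleton, Finset.mem_insert, Set.mem_insert_iff,
        Set.mem_union]; grind),
    ec_ins G (v := c) (by simp; tauto) {c'} (by
      intro w; simp only [Finset.mem_singleton, Set.mem_union]; grind),
    ec_union G disj (by grind), Finset.card_pair dbc, Finset.card_pair d1.symm]
  simp

theorem Tri.G1 [Fintype V] {G : SimpleGraph V} (h : Ctx G) {a b c b' c' : V} {X Y : Set V}
    (t : Tri G a b c b' c' X Y) (hY : Odd (ec G Y))
    (hD : Dec (ind G (insert a (insert b (insert c X))))) : False := by
  have e2 := t.symm.ecX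
  have hDY : Dec (ind G (insert c Y)) := by
    have : G.Adj c c' := (t.nc _).2 (by simp)
    apply (t.rY.insert t.c'Y this).dec
    rw [e2]; exact hY.add_one
  obtain ⟨na, nb, nc, dab, dac, dbc, aX, bX, cX, aY, bY, cY, b'X, c'Y, disj, cov, clX, clY, _, _⟩ := t
  have cc' : G.Adj c c' := (nc _).2 (by simp)
  have ab : G.Adj a b := (na _).2 (by simp)
  have hc'X : c' ∉ X := fun h => disj _ h c'Y
  obtain ⟨c1, hc1⟩ := h.min _ hD ⟨c', c, cc'.symm, by
    simp only [Set.mem_insert_iff]; grind⟩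
  obtain ⟨j, j1, j2⟩ := fin3_avoid (c1 s(c, a)) (c1 s(c, b))
  obtain ⟨c2, hc2, hj⟩ := (h.min _ hDY ⟨a, b, ab, by
    simp only [Set.mem_insert_iff]; grind⟩).fix s(c, c') j
  obtain ⟨C, hC, _⟩ := glue (G := G) (by
      intro u v
      simp only [ind_adj, Set.mem_insert_iff]
      have := G.adj_comm u v
      constructor
      · intro huv
        have h1 := cov u
        have h2 := cov v
        have h3 := clX u v
        have h4 := clY u v
        have h5 := clX v u
        have h6 := clY v u
        grind
      · tauto) (by
      intro u v
      simp only [ind_adj, Set.mem_insert_iff]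
      have := G.ne_of_adj (a := u) (b := v)
      grind) hc1 hc2 (by
      intro v w w'
      simp only [ind_adj, Set.mem_insert_iff]
      intro h1 h2
      have hv : v = c := by grind
      subst hv
      have : w' = c' := by grind
      subst this
      rw [hj]
      have : w = a ∨ w = b := by grind
      rcases this with rfl | rfl
      · exact j1.symm
      · exact j2.symm)
  exact h.ncol ⟨C, hC⟩

/-- color analysis -/
theorem Tri.decOr [Fintype V] {G : SimpleGraph V} {a b c b' c' : V} {X Y : Set V}
    (t : Tri G a b c b' c' X Y) {C : Sym2 V → ℕ} (hC : LI G C) :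
    (C s(c, c') ≠ C s(a, c) ∧ C s(c, c') ≠ C s(b, c)) ∨
    (C s(b, b') ≠ C s(a, b) ∧ C s(b, b') ≠ C s(b, c)) ∨
    (C s(c, c') = C s(a, c) ∧ C s(b, c) = C s(a, c) ∧ C s(a, b) = C s(b, b') ∧
      C s(a, b) ≠ C s(a, c)) ∨
    (C s(b, b') = C s(a, b) ∧ C s(b, c) = C s(a, b) ∧ C s(a, c) = C s(c, c') ∧
      C s(a, b) ≠ C s(a, c)) := by
  obtain ⟨na, nb, nc, dab, dac, dbc, aX, bX, cX, aY, bY, cY, b'X, c'Y, disj, cov, clX, clY, _, _⟩ := t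
  have h1 := hC a b (by grind)
  have h2 := hC a c (by grind)
  have h3 := hC b c (by grind)
  have d1 : b' ≠ c := by grind
  have d2 : b' ≠ a := by grind
  have d3 : c' ≠ a := by grind
  have d4 : c' ≠ b := by grind
  simp only [cd2 dbc na, cd3 dac d2.symm d1.symm nb, cd3 dab d3.symm d4.symm nc] at h1 h2 h3
  rw [Sym2.eq_swap (a := b) (b := a)] at *
  rw [Sym2.eq_swap (a := c) (b := a)] at *
  rw [Sym2.eq_swap (a := c) (b := b)] at *
  generalize C s(a, b) = p at *
  generalize C s(b, c) = q at *
  generalize C s(a, c) = r at *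
  generalize C s(b, b') = s at *
  generalize C s(c, c') = u at *
  grind

theorem Tri.case1 [Fintype V] {G : SimpleGraph V} {a b c b' c' : V} {X Y : Set V}
    (t : Tri G a b c b' c' X Y) {C : Sym2 V → ℕ} (hC : LI G C)
    (hc : C s(c, c') ≠ C s(a, c) ∧ C s(c, c') ≠ C s(b, c)) :
    Dec (ind G (insert a (insert b (insert c X)))) := by
  obtain ⟨na, nb, nc, dab, dac, dbc, aX, bX, cX, aY, bY, cY, b'X, c'Y, disj, cov, clX, clY, _, _⟩ := t
  refine ⟨C, LI_restrict hC (fun _ _ h => h.1) ?_⟩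
  intro v w w'
  simp only [ind_adj, Set.mem_insert_iff]
  intro h1 h2 h3
  have hv : v = c := by grind
  subst hv
  have : w' = c' := by grind
  subst this
  have : w = a ∨ w = b := by grind
  rcases this with rfl | rfl
  · rw [Sym2.eq_swap]; exact hc.1.symm
  · rw [Sym2.eq_swap]; exact hc.2.symm

theorem Tri.case2 [Fintype V] {G : SimpleGraph V} {a b c b' c' : V} {X Y : Set V}
    (t : Tri G a b c b' c' X Y) {C : Sym2 V → ℕ} (hC : LI G C)
    (hc : C s(c, c') = C s(a, c) ∧ C s(b, c) = C s(a, c) ∧ C s(a, b) = C s(b, b') ∧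
      C s(a, b) ≠ C s(a, c)) :
    Dec (ind G (insert a (insert b (insert c X)))) := by
  obtain ⟨na, nb, nc, dab, dac, dbc, aX, bX, cX, aY, bY, cY, b'X, c'Y, disj, cov, clX, clY, _, _⟩ := t
  have ac : G.Adj c a := (nc _).2 (by simp)
  have bc : G.Adj c b := (nc _).2 (by simp)
  have hD : Dec (ind G (insert a (insert b X))) := by
    refine ⟨C, LI_restrict hC (fun _ _ h => h.1) ?_⟩
    intro v w w'
    simp only [ind_adj, Set.mem_insert_iff]
    intro h1 h2 h3
    have hv : v = a ∨ v = b := by grind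
    have : w' = c := by grind
    subst this
    rcases hv with rfl | rfl
    · have : w = b := by grind
      subst this
      exact hc.2.2.2
    · have : w = a ∨ w = b' := by grind
      rcases this with rfl | rfl
      · rw [Sym2.eq_swap]; grind
      · grind
  refine Dec.union ?_ ?_ hD (Dec.star (G := G) (v := c) (p := a) (q := b) (S := {a, b})
    (by simp) (by simp) dab ac bc)
  · intro u v
    simp only [ind_adj, stG_adj, Set.mem_insert_iff, Set.mem_singleton_iff]
    have := G.adj_comm u v
    have := G.ne_of_adj (a := u) (b := v)
    grind
  · intro u v
    simp only [ind_adj, stG_adj, Set.mem_insert_iff, Set.mem_singleton_iff]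
    grind

theorem Tri.swapSet {G : SimpleGraph V} (a b c : V) (X : Set V) :
    (ind G (insert a (insert b (insert c X)))) = ind G (insert a (insert c (insert b X))) := by
  rw [Set.insert_comm b c]

theorem Tri.odd [Fintype V] {G : SimpleGraph V} (h : Ctx G) {a b c b' c' : V} {X Y : Set V}
    (t : Tri G a b c b' c' X Y) (hX : Odd (ec G X)) (hY : Odd (ec G Y)) : False := by
  obtain ⟨C, hC⟩ := h.dec
  rcases t.decOr hC with h1 | h1 | h1 | h1
  · exact t.G1 h hY (t.case1 hC h1)
  · refine t.symm.G1 h hX (t.symm.case1 hC ?_)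
    rw [Sym2.eq_swap (a := c) (b := b)]
    exact h1
  · exact t.G1 h hY (t.case2 hC h1)
  · refine t.symm.G1 h hX (t.symm.case2 hC ?_)
    rw [Sym2.eq_swap (a := c) (b := b)]
    exact ⟨h1.1, h1.2.1, h1.2.2.1, h1.2.2.2.symm⟩

theorem Tri.even [Fintype V] {G : SimpleGraph V} (h : Ctx G) {a b c b' c' : V} {X Y : Set V}
    (t : Tri G a b c b' c' X Y) (hX : Even (ec G X)) (hY : Even (ec G Y)) : False := by
  have e2 := t.symm.ecX
  have cc' : G.Adj c c' := (t.nc _).2 (by simp)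
  have ac : G.Adj a c := (t.na _).2 (by simp)
  have ab : G.Adj a b := (t.na _).2 (by simp)
  have bb' : G.Adj b b' := (t.nb _).2 (by simp)
  have hDX := t.rX.dec hX
  have hDY : Dec (ind G (insert a (insert c Y))) := by
    apply ((t.rY.insert t.c'Y cc').insert (Set.mem_insert _ _) ac).dec
    obtain ⟨na, nb, nc, dab, dac, dbc, aX, bX, cX, aY, bY, cY, b'X, c'Y, disj, cov, clX, clY, _, _⟩ := t
    rw [ec_ins G (v := a) (by simp; tauto) {c} (by
      intro w; simp only [Finset.mem_singleton, Set.mem_insert_iff]; grind), e2,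
      Finset.card_singleton, add_assoc, Nat.even_add]
    simp [hY]
  obtain ⟨na, nb, nc, dab, dac, dbc, aX, bX, cX, aY, bY, cY, b'X, c'Y, disj, cov, clX, clY, _, _⟩ := t
  obtain ⟨c1, hc1⟩ := h.min _ hDX ⟨a, b, ab, aX⟩
  obtain ⟨p, q, hpq⟩ := nb_le (h.deg b') bb'.symm
  obtain ⟨j, j1, j2⟩ := fin3_avoid (c1 s(b', p)) (c1 s(b', q))
  obtain ⟨j', hj', _⟩ := fin3_avoid j j
  obtain ⟨c2, hc2, hj⟩ := (h.min _ hDY ⟨b, a, ab.symm, by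
    simp only [Set.mem_insert_iff]; grind⟩).fix s(a, c) j'
  have hj2 : c2 s(c, c') = j' := by
    rw [← hj]
    apply leaf_color hc2 (by grind)
    · intro w; simp only [ind_adj, Set.mem_insert_iff]; grind
    · intro w; simp only [ind_adj, Set.mem_insert_iff]; grind
  obtain ⟨C, hC, hC1, hC2⟩ := glue (G := ind G {b}ᶜ) (by
      intro u v
      simp only [ind_adj, Set.mem_insert_iff, Set.mem_compl_iff, Set.mem_singleton_iff]
      have := G.adj_comm u v
      constructor
      · rintro ⟨huv, hu1, hv1⟩
        have h1 := cov u
        have h2 := cov v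
        have h3 := clX u v
        have h4 := clY u v
        have h5 := clX v u
        have h6 := clY v u
        grind
      · grind) (by
      intro u v
      simp only [ind_adj, Set.mem_insert_iff]
      grind) hc1 hc2 (by
      intro v w w'
      simp only [ind_adj, Set.mem_insert_iff]
      intro h1 h2
      grind)
  obtain ⟨D, hD, _⟩ := glue (G := G) (H₁ := ind G {b}ᶜ) (H₂ := stG G b Set.univ) (by
      intro u v
      simp only [ind_adj, stG_adj, Set.mem_compl_iff, Set.mem_singleton_iff, Set.mem_univ, and_true]
      tauto) (by
      intro u v
      simp only [ind_adj, stG_adj, Set.mem_compl_iff, Set.mem_singleton_iff, Set.mem_univ, and_true]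
      tauto) hC (LI_star (p := a) (q := b') (by simp) (by simp) (by grind) ab.symm bb' j) (by
      intro v w w'
      simp only [ind_adj, stG_adj, Set.mem_compl_iff, Set.mem_singleton_iff, Set.mem_univ, and_true]
      intro h1 h2
      have hw' : w' = b := by tauto
      subst hw'
      have hv : v = a ∨ v = c ∨ v = b' := by grind
      rcases hv with rfl | rfl | rfl
      · have : w = c := by grind
        subst this
        rw [hC2 _ _ (by simp only [ind_adj, Set.mem_insert_iff]; grind), hj]
        exact hj'
      · have : w = a ∨ w = c' := by grind
        rcases this with rfl | rfl
        · rw [hC2 _ _ (by simp only [ind_adj, Set.mem_insert_iff]; grind), Sym2.eq_swap, hj]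
          exact hj'
        · rw [hC2 _ _ (by simp only [ind_adj, Set.mem_insert_iff]; grind), hj2]
          exact hj'
      · rw [hC1 _ _ (by simp only [ind_adj]; grind)]
        rcases hpq w h1.1 with rfl | rfl | rfl
        · tauto
        · exact j1.symm
        · exact j2.symm)
  exact h.ncol ⟨D, hD⟩


theorem comps {G : SimpleGraph V} (hc : G.Connected) (K : Set V) {k0 b' c' : V} (hk : k0 ∈ K)
    (hb : b' ∉ K) (hc' : c' ∉ K) (hex : ∀ k ∈ K, ∀ r, r ∉ K → G.Adj k r → r = b' ∨ r = c') :
    RC G Kᶜ c' ∨ ∃ X Y : Set V, b' ∈ X ∧ c' ∈ Y ∧ (∀ v ∈ X, v ∉ Y) ∧ (∀ v, v ∈ K ∨ v ∈ X ∨ v ∈ Y) ∧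
      (∀ v ∈ X, v ∉ K) ∧ (∀ v ∈ Y, v ∉ K) ∧ (∀ u v, u ∈ X → G.Adj u v → v ∈ X ∨ v ∈ K) ∧
      (∀ u v, u ∈ Y → G.Adj u v → v ∈ Y ∨ v ∈ K) ∧ RC G X b' ∧ RC G Y c' := by
  by_cases hr : (ind G Kᶜ).Reachable c' b'
  · left
    intro v hv
    obtain ⟨r, h1, ⟨k, h2, h3⟩, h4⟩ := exit hc K hk v hv
    rcases hex k h2 r h1 h3 with rfl | rfl
    · exact hr.trans h4
    · exact h4
  · right
    have cl : ∀ r, r ∉ K → ∀ u v, (ind G Kᶜ).Reachable r u → G.Adj u v →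
        (ind G Kᶜ).Reachable r v ∨ v ∈ K := by
      intro r hr u v hu huv
      by_cases hv : v ∈ K
      · exact Or.inr hv
      · exact Or.inl (hu.trans (SimpleGraph.Adj.reachable ⟨huv, comp_sub hr u hu, hv⟩))
    refine ⟨{v | (ind G Kᶜ).Reachable b' v}, {v | (ind G Kᶜ).Reachable c' v},
      SimpleGraph.Reachable.refl _, SimpleGraph.Reachable.refl _,
      fun v hv hv' => hr (SimpleGraph.Reachable.trans hv' (SimpleGraph.Reachable.symm hv)),
      ?_, fun v hv => comp_sub hb v hv, fun v hv => comp_sub hc' v hv,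
      cl _ hb, cl _ hc', RC_comp G _ _, RC_comp G _ _⟩
    intro v
    by_cases hv : v ∈ K
    · exact Or.inl hv
    right
    obtain ⟨r, h1, ⟨k, h2, h3⟩, h4⟩ := exit hc K hk v hv
    rcases hex k h2 r h1 h3 with rfl | rfl
    · exact Or.inl h4
    · exact Or.inr h4

/-- `A`-configuration: `a` of degree 2, `b` and `c` of degree 3 -/
theorem S1A [Fintype V] {G : SimpleGraph V} (h : Ctx G) {a b c b' c' : V}
    (na : ∀ w, G.Adj a w ↔ w = b ∨ w = c) (nb : ∀ w, G.Adj b w ↔ w = a ∨ w = c ∨ w = b')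
    (nc : ∀ w, G.Adj c w ↔ w = a ∨ w = b ∨ w = c') (b'a : b' ≠ a) (b'c : b' ≠ c)
    (c'a : c' ≠ a) (c'b : c' ≠ b) : False := by
  have ab : G.Adj a b := (na _).2 (by simp)
  have ac : G.Adj a c := (na _).2 (by simp)
  have bc : G.Adj b c := (nb _).2 (by simp)
  have bb' : G.Adj b b' := (nb _).2 (by simp)
  have cc' : G.Adj c c' := (nc _).2 (by simp)
  have sym : ∀ u v, G.Adj u v → G.Adj v u := fun u v h => h.symm
  have irr : ∀ u v, G.Adj u v → u ≠ v := fun u v h => h.ne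
  have dab := ab.ne
  have dac := ac.ne
  have dbc := bc.ne
  have dbb := bb'.ne
  have dcc := cc'.ne
  have hodd := odd_of_tri2 h bc na
  have hK : ∀ x, x ∈ ({a, b, c} : Set V) ↔ x = a ∨ x = b ∨ x = c := by intro x; simp
  rcases comps h.conn {a, b, c} (k0 := a) (b' := b') (c' := c') (by simp) (by rw [hK]; grind)
    (by rw [hK]; grind) (by intro k hk r hr hkr; rw [hK] at hk hr; grind) with hT | ⟨X, Y, h1, h2, h3, h4, h5, h6, h7, h8, h9, h10⟩
  · have mT : ∀ x, x ∈ ({a, b, c} : Set V)ᶜ ↔ x ≠ a ∧ x ≠ b ∧ x ≠ c := by intro x; simp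
    generalize ({a, b, c} : Set V)ᶜ = T at *
    clear hK
    by_cases hA : b' ≠ c' ∧ ∃ f g, f ≠ g ∧ f ∈ T ∧ g ∈ T ∧ G.Adj b' f ∧ G.Adj b' g
    · obtain ⟨hbc', f, g, hfg, hf, hg, af, ag⟩ := hA
      rw [mT] at hf hg
      have nb' := nb_le3 (h.deg b') bb'.symm af ag (by grind) (by grind) hfg
      have hR : RC G (T \ {b'}) c' := by
        apply hT.simp hbc'.symm
        intro x hx y hy hx1 hy1
        rw [mT] at hx hy
        by_cases hxy : x = y
        · exact Or.inl hxy
        have := h.claw b' b x y (by grind) (by grind) hxy bb'.symm hx1 hy1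
        grind
      have hR2 := (hR.insert (v := c) (p := c') ⟨by rw [mT]; grind, by simp; grind⟩ cc').insert
        (v := b) (p := c) (by simp) bc
      have e1 := ec_ins G (S := insert b (insert c (T \ {b'}))) (v := b') (by
        simp; grind) {b, f, g} (by
        intro w; simp only [Finset.mem_insert, Finset.mem_singleton, Set.mem_insert_iff, Set.mem_sdiff, mT, Set.mem_singleton_iff]
        grind)
      have e2 := ec_ins G (S := insert b' (insert b (insert c (T \ {b'})))) (v := a) (by
        simp [mT]; grind) {b, c} (by
        intro w; simp only [Finset.mem_insert, Finset.mem_singleton, Set.mem_insert_iff, Set.mem_sdiff, mT, Set.mem_singleton_iff]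
        grind)
      have hu : insert a (insert b' (insert b (insert c (T \ {b'})))) = Set.univ := by
        ext w; simp only [Set.mem_insert_iff, Set.mem_sdiff, mT, Set.mem_singleton_iff, Set.mem_univ]; grind
      rw [hu, e1, Finset.card_pair dbc, Finset.card_eq_three.2 ⟨b, f, g, by grind, by grind, hfg, rfl⟩] at e2
      have hev : Even (ec G (insert b (insert c (T \ {b'})))) := by
        rw [Nat.not_even_iff] at hodd; rw [Nat.even_iff]; omega
      refine starA h ab ac bc (insert b' (insert b (insert c (T \ {b'})))) ?_ ?_ ?_ ?_
      · simp [mT]; grind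
      · intro u v; simp only [Set.mem_insert_iff, Set.mem_sdiff, mT, Set.mem_singleton_iff]; grind
      · intro w _ hw; exact (na w).1 hw
      · refine Dec.union ?_ ?_ (hR2.dec hev) (Dec.star (G := G) (v := b') (p := f) (q := g) (S := {b, f, g})
          (by simp) (by simp) hfg af ag)
        · intro u v
          simp only [ind_adj, stG_adj, Set.mem_insert_iff, Set.mem_sdiff, mT, Set.mem_singleton_iff]
          have := G.adj_comm u v
          have := G.ne_of_adj (a := u) (b := v)
          grind
        · intro u v
          simp only [ind_adj, stG_adj, Set.mem_insert_iff, Set.mem_sdiff, mT, Set.mem_singleton_iff]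
          grind
    · have hf : ∃ f, ∀ w, G.Adj b' w → w ∈ T → w ≠ b → b' ≠ c' → w = f := by
        by_cases hf : ∃ f, f ∈ T ∧ G.Adj b' f
        · obtain ⟨f, hf1, hf2⟩ := hf
          refine ⟨f, fun w h1 h2 h3 h4 => ?_⟩
          by_contra h5
          exact hA ⟨h4, w, f, h5, h2, hf1, h1, hf2⟩
        · exact ⟨a, fun w h1 h2 _ => absurd ⟨w, h2, h1⟩ hf⟩
      obtain ⟨f, hf⟩ := hf
      have hf2 : ∃ f, ∀ w, G.Adj b' w → w = b ∨ w = f ∨ (w = c ∧ b' = c') := by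
        by_cases hbc' : b' = c'
        · subst hbc'
          obtain ⟨p, hp⟩ := nb_le2 (h.deg b') bb'.symm cc'.symm dbc
          exact ⟨p, fun w hw => by have := hp w hw; tauto⟩
        · refine ⟨f, fun w hw => ?_⟩
          have := hf w hw
          rw [mT] at this
          have := G.adj_comm w b'
          grind
      clear hf
      clear f
      obtain ⟨f, hf⟩ := hf2
      have hc'T : c' ∈ T := by rw [mT]; grind
      have hR := (hT.insert (v := c) hc'T cc').insert (v := a) (p := c) (by simp) ac
      have e1 := ec_ins G (S := insert a (insert c T)) (v := b) (by
        simp [mT]; grind) {a, c, b'} (by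
        intro w; simp only [Finset.mem_insert, Finset.mem_singleton, Set.mem_insert_iff, mT]
        grind)
      have hu : insert b (insert a (insert c T)) = Set.univ := by
        ext w; simp only [Set.mem_insert_iff, mT, Set.mem_univ]; grind
      rw [hu, Finset.card_eq_three.2 ⟨a, c, b', by grind, by grind, by grind, rfl⟩] at e1
      have hev : Even (ec G (insert a (insert c T))) := by
        rw [Nat.not_even_iff] at hodd; rw [Nat.even_iff]; omega
      obtain ⟨c1, hc1⟩ := h.min _ (hR.dec hev) ⟨b, a, ab.symm, by simp [mT]; grind⟩
      have hl : c1 s(c, c') = c1 s(a, c) := by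
        apply leaf_color hc1 (by grind)
        · intro w; simp only [ind_adj, Set.mem_insert_iff, mT]; grind
        · intro w; simp only [ind_adj, Set.mem_insert_iff, mT]; grind
      obtain ⟨j, j1, j2⟩ := fin3_avoid (c1 s(a, c)) (c1 s(b', f))
      obtain ⟨D, hD, _⟩ := glue (G := G) (H₁ := ind G (insert a (insert c T))) (H₂ := stG G b Set.univ) (by
        intro u v
        simp only [ind_adj, stG_adj, Set.mem_insert_iff, mT, Set.mem_univ, and_true]
        have := G.ne_of_adj (a := u) (b := v)
        grind) (by
        intro u v
        simp only [ind_adj, stG_adj, Set.mem_insert_iff, mT, Set.mem_univ, and_true]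
        grind) hc1 (LI_star (p := a) (q := b') (by simp) (by simp) (by grind) ab.symm bb' j) (by
        intro v w w'
        simp only [ind_adj, stG_adj, Set.mem_insert_iff, mT, Set.mem_univ, and_true]
        intro h1 h2
        have hw' : w' = b := by grind
        have hv : v = a ∨ v = c ∨ v = b' := by grind
        rcases hv with rfl | rfl | rfl
        · have : w = c := by grind
          subst this
          exact j1.symm
        · have : w = a ∨ w = c' := by grind
          rcases this with rfl | rfl
          · rw [Sym2.eq_swap]; exact j1.symm
          · rw [hl]; exact j1.symm
        · rcases hf w h1.1 with rfl | rfl | ⟨rfl, h3⟩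
          · grind
          · exact j2.symm
          · subst h3; rw [Sym2.eq_swap, hl]; exact j1.symm)
      exact h.ncol ⟨D, hD⟩
  · simp only [hK] at h4 h5 h6 h7 h8
    have t : Tri G a b c b' c' X Y := {
      na := na, nb := nb, nc := nc, dab := dab, dac := dac, dbc := dbc
      aX := by grind
      bX := by grind
      cX := by grind
      aY := by grind
      bY := by grind
      cY := by grind
      b'X := h1, c'Y := h2, disj := h3
      cov := by grind
      clX := by
        intro u v hu huv hv
        have := h7 u v hu huv
        have := G.adj_comm u v
        grind
      clY := by
        intro u v hu huv hv
        have := h8 u v hu huv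
        have := G.adj_comm u v
        grind
      rX := h9, rY := h10 }
    have := t.ecUniv
    rw [this] at hodd
    by_cases hX : Even (ec G X)
    · refine t.even h hX ?_
      rw [Nat.even_iff] at *; omega
    · refine t.odd h (Nat.not_even_iff_odd.1 hX) ?_
      rw [Nat.even_iff] at *; rw [Nat.odd_iff]; omega

structure Pend (G : SimpleGraph V) (a b c b' : V) : Prop where
  na : ∀ w, G.Adj a w ↔ w = b ∨ w = c
  nb : ∀ w, G.Adj b w ↔ w = a ∨ w = c ∨ w = b'
  nc : ∀ w, G.Adj c w ↔ w = a ∨ w = b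
  b'a : b' ≠ a
  b'c : b' ≠ c

theorem Pend.B1 [Fintype V] {G : SimpleGraph V} (h : Ctx G) {a b c b' : V} (t : Pend G a b c b')
    {X : Set V} (mX : ∀ x, x ∈ X ↔ x ≠ a ∧ x ≠ b ∧ x ≠ c) (hD : Dec (ind G X)) : False := by
  obtain ⟨na, nb, nc, b'a, b'c⟩ := t
  have ab : G.Adj a b := (na _).2 (by simp)
  have ac : G.Adj a c := (na _).2 (by simp)
  have bc : G.Adj b c := (nb _).2 (by simp)
  have bb' : G.Adj b b' := (nb _).2 (by simp)
  have sym : ∀ u v, G.Adj u v → G.Adj v u := fun u v h => h.symm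
  have irr : ∀ u v, G.Adj u v → u ≠ v := fun u v h => h.ne
  have dab := ab.ne
  have dac := ac.ne
  have dbc := bc.ne
  have dbb := bb'.ne
  obtain ⟨c1, hc1⟩ := h.min _ hD ⟨a, b, ab, by rw [mX]; grind⟩
  obtain ⟨p, q, hpq⟩ := nb_le (h.deg b') bb'.symm
  obtain ⟨j, j1, j2⟩ := fin3_avoid (c1 s(b', p)) (c1 s(b', q))
  obtain ⟨j', hj', _⟩ := fin3_avoid j j
  obtain ⟨c2, hc2, hC2, _⟩ := glue (G := stG G b {b', a} ⊔ stG G c {a, b})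
    (H₁ := stG G b {b', a}) (H₂ := stG G c {a, b}) (κ := Fin 3) (fun u v => Iff.rfl) (by
      intro u v
      simp only [stG_adj, Set.mem_insert_iff, Set.mem_singleton_iff]
      grind) (LI_star (p := b') (q := a) (by simp) (by simp) b'a bb' ab.symm j)
      (LI_star (p := a) (q := b) (by simp) (by simp) dab ac.symm bc.symm j') (by
      intro v w w' _ _
      exact hj'.symm)
  obtain ⟨D, hD, _⟩ := glue (G := G) (H₁ := ind G X) (H₂ := stG G b {b', a} ⊔ stG G c {a, b})
    (κ := Fin 3) (by
      intro u v
      simp only [ind_adj, SimpleGraph.sup_adj, stG_adj, mX, Set.mem_insert_iff, Set.mem_singleton_iff]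
      grind) (by
      intro u v
      simp only [ind_adj, SimpleGraph.sup_adj, stG_adj, mX, Set.mem_insert_iff, Set.mem_singleton_iff]
      grind) hc1 hc2 (by
      intro v w w'
      simp only [ind_adj, SimpleGraph.sup_adj, stG_adj, mX, Set.mem_insert_iff, Set.mem_singleton_iff]
      intro h1 h2
      have hv : v = b' := by grind
      have hw : w' = b := by grind
      subst hv hw
      rw [hC2 _ _ (by simp only [stG_adj, Set.mem_insert_iff, Set.mem_singleton_iff]; grind)]
      rcases hpq w h1.1 with rfl | rfl | rfl
      · grind
      · exact j1.symm
      · exact j2.symm)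
  exact h.ncol ⟨D, hD⟩

theorem Pend.B2 [Fintype V] {G : SimpleGraph V} (h : Ctx G) {a b c b' f g f' g' : V}
    (t : Pend G a b c b') {Q R : Set V} (nb' : ∀ w, G.Adj b' w ↔ w = b ∨ w = f ∨ w = g)
    (nf : ∀ w, G.Adj f w ↔ w = b' ∨ w = g ∨ w = f')
    (ng : ∀ w, G.Adj g w ↔ w = b' ∨ w = f ∨ w = g')
    (dQ : ∀ v ∈ Q, v ≠ a ∧ v ≠ b ∧ v ≠ c ∧ v ≠ b' ∧ v ≠ f ∧ v ≠ g)
    (dR : ∀ v ∈ R, v ≠ a ∧ v ≠ b ∧ v ≠ c ∧ v ≠ b' ∧ v ≠ f ∧ v ≠ g)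
    (dQR : ∀ v ∈ Q, v ∉ R)
    (cov : ∀ v, v = a ∨ v = b ∨ v = c ∨ v = b' ∨ v = f ∨ v = g ∨ v ∈ Q ∨ v ∈ R)
    (clQ : ∀ u v, u ∈ Q → G.Adj u v → v ∉ Q → u = f' ∧ v = f)
    (clR : ∀ u v, u ∈ R → G.Adj u v → v ∉ R → u = g' ∧ v = g)
    (hf' : f' ∈ Q) (hg' : g' ∈ R) (rR : RC G R g') (oR : Odd (ec G R))
    {C : Sym2 V → ℕ} (hC : LI G C) (h1 : C s(f, f') = C s(f, g)) (h2 : C s(g, g') ≠ C s(f, g))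
    (h3 : C s(b', f) ≠ C s(f, g)) (h4 : C s(b', g) ≠ C s(f, g)) : False := by
  obtain ⟨na, nb, nc, b'a, b'c⟩ := t
  have ab : G.Adj a b := (na _).2 (by simp)
  have ac : G.Adj a c := (na _).2 (by simp)
  have bc : G.Adj b c := (nb _).2 (by simp)
  have bb' : G.Adj b b' := (nb _).2 (by simp)
  have b'f : G.Adj b' f := (nb' _).2 (by simp)
  have b'g : G.Adj b' g := (nb' _).2 (by simp)
  have fg : G.Adj f g := (nf _).2 (by simp)
  have gg' : G.Adj g g' := (ng _).2 (by simp)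
  have sym : ∀ u v, G.Adj u v → G.Adj v u := fun u v h => h.symm
  have irr : ∀ u v, G.Adj u v → u ≠ v := fun u v h => h.ne
  have dab := ab.ne
  have dac := ac.ne
  have dbc := bc.ne
  have dbb := bb'.ne
  have dfg := fg.ne
  have db'f := b'f.ne
  have db'g := b'g.ne
  have daf : a ≠ f := by grind
  have dag : a ≠ g := by grind
  have dbf : b ≠ f := by grind
  have dbg : b ≠ g := by grind
  have dcf : c ≠ f := by grind
  have dcg : c ≠ g := by grind
  have hD1 : Dec (ind G (insert f (insert g Q))) := by
    refine ⟨C, LI_restrict hC (fun _ _ h => h.1) ?_⟩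
    intro v w w'
    simp only [ind_adj, Set.mem_insert_iff]
    intro k1 k2 k3
    have hv : v = f ∨ v = g := by grind
    rcases hv with rfl | rfl
    · have : w' = b' := by grind
      subst this
      have : w = g ∨ w = f' := by grind
      rcases this with rfl | rfl
      · rw [Sym2.eq_swap (a := v) (b := w')]; exact h3.symm
      · rw [Sym2.eq_swap (a := v) (b := w'), h1]; exact h3.symm
    · have : w = f := by grind
      subst this
      have : w' = b' ∨ w' = g' := by grind
      rcases this with rfl | rfl
      · rw [Sym2.eq_swap (a := v) (b := w'), Sym2.eq_swap (a := v) (b := w)]; exact h4.symm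
      · rw [Sym2.eq_swap (a := v) (b := w)]; exact h2.symm
  have hD2 : Dec (ind G (insert b' (insert f (insert g Q)))) := by
    refine Dec.union ?_ ?_ hD1 (Dec.star (G := G) (v := b') (p := f) (q := g) (S := {f, g})
      (by simp) (by simp) dfg b'f b'g)
    · intro u v
      simp only [ind_adj, stG_adj, Set.mem_insert_iff, Set.mem_singleton_iff]
      grind
    · intro u v
      simp only [ind_adj, stG_adj, Set.mem_insert_iff, Set.mem_singleton_iff]
      grind
  have hD3 : Dec (ind G (insert a (insert b (insert b' (insert f (insert g Q)))))) := by
    refine Dec.union ?_ ?_ hD2 (Dec.star (G := G) (v := b) (p := a) (q := b') (S := {a, b'})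
      (by simp) (by simp) b'a.symm ab.symm bb')
    · intro u v
      simp only [ind_adj, stG_adj, Set.mem_insert_iff, Set.mem_singleton_iff]
      grind
    · intro u v
      simp only [ind_adj, stG_adj, Set.mem_insert_iff, Set.mem_singleton_iff]
      grind
  have hD4 : Dec (ind G Rᶜ) := by
    refine Dec.union ?_ ?_ hD3 (Dec.star (G := G) (v := c) (p := a) (q := b) (S := {a, b})
      (by simp) (by simp) dab ac.symm bc.symm)
    · intro u v
      simp only [ind_adj, stG_adj, Set.mem_insert_iff, Set.mem_singleton_iff, Set.mem_compl_iff]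
      have := cov u
      have := cov v
      grind
    · intro u v
      simp only [ind_adj, stG_adj, Set.mem_insert_iff, Set.mem_singleton_iff]
      grind
  have hgR : g ∉ R := by grind
  have hD5 : Dec (ind G (insert g R)) := by
    apply (rR.insert hg' gg').dec
    rw [ec_ins G hgR {g'} (by intro w; simp only [Finset.mem_singleton]; grind)]
    exact oR.add_one
  obtain ⟨c1, hc1⟩ := h.min _ hD4 ⟨g', g, gg'.symm, by simpa using hg'⟩
  obtain ⟨j, j1, j2⟩ := fin3_avoid (c1 s(g, b')) (c1 s(g, f))
  obtain ⟨c2, hc2, hj⟩ := (h.min _ hD5 ⟨a, b, ab, by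
    simp only [Set.mem_insert_iff]; grind⟩).fix s(g, g') j
  obtain ⟨D, hD, _⟩ := glue (G := G) (by
      intro u v
      simp only [ind_adj, Set.mem_insert_iff, Set.mem_compl_iff]
      grind) (by
      intro u v
      simp only [ind_adj, Set.mem_insert_iff, Set.mem_compl_iff]
      grind) hc1 hc2 (by
      intro v w w'
      simp only [ind_adj, Set.mem_insert_iff, Set.mem_compl_iff]
      intro k1 k2
      have hv : v = g := by grind
      subst hv
      have : w' = g' := by grind
      subst this
      rw [hj]
      have : w = b' ∨ w = f := by grind
      rcases this with rfl | rfl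
      · exact j1.symm
      · exact j2.symm)
  exact h.ncol ⟨D, hD⟩

set_option maxHeartbeats 1000000 in
theorem Pend.B3 [Fintype V] {G : SimpleGraph V} (h : Ctx G) {a b c b' f g f' g' : V}
    (t : Pend G a b c b') {X : Set V} (mX : ∀ x, x ∈ X ↔ x ≠ a ∧ x ≠ b ∧ x ≠ c)
    (oX : Odd (ec G X)) (nb' : ∀ w, G.Adj b' w ↔ w = b ∨ w = f ∨ w = g)
    (nf : ∀ w, G.Adj f w ↔ w = b' ∨ w = g ∨ w = f')
    (ng : ∀ w, G.Adj g w ↔ w = b' ∨ w = f ∨ w = g') (f1 : f' ≠ b') (f2 : f' ≠ g)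
    (g1 : g' ≠ b') (g2 : g' ≠ f)
    {C : Sym2 V → ℕ} (hC : LI G C)
    (h3 : C s(b', f) ≠ C s(f, g)) (h4 : C s(b', g) ≠ C s(f, g)) : False := by
  have t0 := t
  obtain ⟨na, nb, nc, b'a, b'c⟩ := t
  have ab : G.Adj a b := (na _).2 (by simp)
  have ac : G.Adj a c := (na _).2 (by simp)
  have bc : G.Adj b c := (nb _).2 (by simp)
  have bb' : G.Adj b b' := (nb _).2 (by simp)
  have b'f : G.Adj b' f := (nb' _).2 (by simp)
  have b'g : G.Adj b' g := (nb' _).2 (by simp)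
  have fg : G.Adj f g := (nf _).2 (by simp)
  have gg' : G.Adj g g' := (ng _).2 (by simp)
  have ff' : G.Adj f f' := (nf _).2 (by simp)
  have sym : ∀ u v, G.Adj u v → G.Adj v u := fun u v h => h.symm
  have irr : ∀ u v, G.Adj u v → u ≠ v := fun u v h => h.ne
  have dab := ab.ne
  have dac := ac.ne
  have dbc := bc.ne
  have dbb := bb'.ne
  have dfg := fg.ne
  have db'f := b'f.ne
  have db'g := b'g.ne
  have daf : a ≠ f := by grind
  have dag : a ≠ g := by grind
  have dbf : b ≠ f := by grind
  have dbg : b ≠ g := by grind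
  have dcf : c ≠ f := by grind
  have dcg : c ≠ g := by grind
  have hK : ∀ x, x ∈ ({a, b, c, b', f, g} : Set V) ↔ x = a ∨ x = b ∨ x = c ∨ x = b' ∨ x = f ∨ x = g := by
    intro x; simp
  rcases comps h.conn {a, b, c, b', f, g} (k0 := a) (b' := f') (c' := g') (by simp) (by rw [hK]; grind)
    (by rw [hK]; grind) (by intro k hk r hr hkr; rw [hK] at hk hr; grind) with hT | ⟨Q, R, h1, h2, dQR, cov, dQ, dR, clQ, clR, rQ, rR⟩
  · have mT : ∀ x, x ∈ ({a, b, c, b', f, g} : Set V)ᶜ ↔ x ≠ a ∧ x ≠ b ∧ x ≠ c ∧ x ≠ b' ∧ x ≠ f ∧ x ≠ g := by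
      intro x; simp
    generalize ({a, b, c, b', f, g} : Set V)ᶜ = T at *
    clear hK
    have hg'T : g' ∈ T := by rw [mT]; grind
    have hR := (hT.insert (v := g) hg'T gg').insert (v := b') (p := g) (by simp) b'g
    have e1 := ec_ins G (S := insert b' (insert g T)) (v := f) (by
        simp only [Set.mem_insert_iff, mT]; grind) {b', g, f'} (by
        intro w; simp only [Finset.mem_insert, Finset.mem_singleton, Set.mem_insert_iff, mT]
        grind)
    have hu : insert f (insert b' (insert g T)) = X := by
        ext w; simp only [Set.mem_insert_iff, mT, mX]; grind
    rw [hu, Finset.card_eq_three.2 ⟨b', g, f', db'g, f1.symm, f2.symm, rfl⟩] at e1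
    have hev : Even (ec G (insert b' (insert g T))) := by
      rw [Nat.odd_iff] at oX; rw [Nat.even_iff]; omega
    refine t0.B1 h mX ?_
    refine Dec.union ?_ ?_ (hR.dec hev) (Dec.star (G := G) (v := f) (p := b') (q := g) (S := {b', g, f'})
      (by simp) (by simp) db'g b'f.symm fg)
    · intro u v
      simp only [ind_adj, stG_adj, Set.mem_insert_iff, mT, mX, Set.mem_singleton_iff]
      grind
    · intro u v
      simp only [ind_adj, stG_adj, Set.mem_insert_iff, mT, Set.mem_singleton_iff]
      grind
  · simp only [hK] at cov dQ dR clQ clR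
    clear hK
    have dQ' : ∀ v ∈ Q, v ≠ a ∧ v ≠ b ∧ v ≠ c ∧ v ≠ b' ∧ v ≠ f ∧ v ≠ g := by grind
    have dR' : ∀ v ∈ R, v ≠ a ∧ v ≠ b ∧ v ≠ c ∧ v ≠ b' ∧ v ≠ f ∧ v ≠ g := by grind
    have cov' : ∀ v, v = a ∨ v = b ∨ v = c ∨ v = b' ∨ v = f ∨ v = g ∨ v ∈ Q ∨ v ∈ R := by
      intro v; have := cov v; tauto
    clear cov dQ dR
    have clQ' : ∀ u v, u ∈ Q → G.Adj u v → v ∉ Q → u = f' ∧ v = f := by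
      intro u v hu huv hv
      have := clQ u v hu huv
      have := huv.symm
      grind
    have clR' : ∀ u v, u ∈ R → G.Adj u v → v ∉ R → u = g' ∧ v = g := by
      intro u v hu huv hv
      have := clR u v hu huv
      have := huv.symm
      grind
    clear clQ clR
    have hX : X = insert b' (insert g (insert f (Q ∪ R))) := by
      ext v
      simp only [mX, Set.mem_insert_iff, Set.mem_union]
      have := cov' v
      grind
    have eX : ec G X = ec G Q + ec G R + 5 := by
      rw [hX, ec_ins G (v := b') (by simp only [Set.mem_insert_iff, Set.mem_union]; grind) {f, g} (by
          intro w; simp only [Finset.mem_singleton, Finset.mem_insert, Set.mem_insert_iff,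
            Set.mem_union]; grind),
        ec_ins G (v := g) (by simp only [Set.mem_insert_iff, Set.mem_union]; grind) {f, g'} (by
          intro w; simp only [Finset.mem_singleton, Finset.mem_insert, Set.mem_insert_iff,
            Set.mem_union]; grind),
        ec_ins G (v := f) (by simp only [Set.mem_union]; grind) {f'} (by
          intro w; simp only [Finset.mem_singleton, Set.mem_union]; grind),
        ec_union G dQR (by grind), Finset.card_pair dfg, Finset.card_pair g2.symm]
      simp
    by_cases hQ : Even (ec G Q)
    · have hR : Even (ec G (insert b' (insert g R))) := by
        rw [ec_ins G (v := b') (by simp only [Set.mem_insert_iff]; grind) {g} (by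
          intro w; simp only [Finset.mem_singleton, Set.mem_insert_iff]; grind),
        ec_ins G (v := g) (by grind) {g'} (by
          intro w; simp only [Finset.mem_singleton]; grind), Finset.card_singleton,
          Finset.card_singleton]
        rw [Nat.odd_iff] at oX; rw [Nat.even_iff] at *; omega
      have rR2 := (rR.insert (v := g) h2 gg').insert (v := b') (p := g) (by simp) b'g
      refine t0.B1 h mX ?_
      have hD := Dec.union (G := ind G (Q ∪ (insert b' (insert g R)))) (by
        intro u v
        simp only [ind_adj, Set.mem_insert_iff, Set.mem_union]
        grind) (by
        intro u v
        simp only [ind_adj, Set.mem_insert_iff]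
        grind) (rQ.dec hQ) (rR2.dec hR)
      refine Dec.union ?_ ?_ hD (Dec.star (G := G) (v := f) (p := b') (q := g) (S := {b', g, f'})
        (by simp) (by simp) db'g b'f.symm fg)
      · intro u v
        simp only [ind_adj, stG_adj, Set.mem_insert_iff, mX, Set.mem_union, Set.mem_singleton_iff]
        constructor
        · rintro ⟨huv, hu1, hv1⟩
          have := huv.symm
          rcases cov' u with rfl | rfl | rfl | rfl | rfl | rfl | hu | hu
          · tauto
          · tauto
          · tauto
          · rw [nb'] at huv; grind
          · rw [nf] at huv; grind
          · rw [ng] at huv; grind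
          · grind
          · grind
        · grind
      · intro u v
        simp only [ind_adj, stG_adj, Set.mem_insert_iff, Set.mem_union, Set.mem_singleton_iff]
        grind
    · have oQ := Nat.not_even_iff_odd.1 hQ
      have oR : Odd (ec G R) := by
        rw [Nat.odd_iff] at *; omega
      have hE := hC f g fg
      rw [cd3 db'g f1.symm f2.symm nf, cd3 db'f g1.symm g2.symm ng, Sym2.eq_swap (a := f) (b := b'),
        Sym2.eq_swap (a := g) (b := b'), Sym2.eq_swap (a := g) (b := f)] at hE
      by_cases k : C s(f, f') = C s(f, g)
      · refine t0.B2 h nb' nf ng dQ' dR' dQR cov' clQ' clR' h1 h2 rR oR hC k ?_ h3 h4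
        intro k2
        simp [h3, h4, k, k2] at hE
      · have k2 : C s(g, g') = C s(f, g) := by
          by_contra k2
          simp [h3, h4, k, k2] at hE
        refine t0.B2 h (f := g) (g := f) (f' := g') (g' := f') ?_ ng nf (by grind) (by grind) (by grind)
          (by intro v; have := cov' v; tauto) clR' clQ' h2 h1 rQ oQ hC ?_ ?_ ?_ ?_
        · intro w; rw [nb' w]; tauto
        · rw [k2, Sym2.eq_swap]
        · rw [Sym2.eq_swap (a := g) (b := f)]; exact k
        · rw [Sym2.eq_swap (a := g) (b := f)]; exact h4
        · rw [Sym2.eq_swap (a := g) (b := f)]; exact h3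

theorem RC_one {G : SimpleGraph V} (hc : G.Connected) (K : Set V) {k0 b' : V} (hk : k0 ∈ K)
    (hex : ∀ k ∈ K, ∀ r, r ∉ K → G.Adj k r → r = b') : RC G Kᶜ b' := by
  intro v hv
  obtain ⟨r, h1, ⟨k, h2, h3⟩, h4⟩ := exit hc K hk v hv
  rw [hex k h2 r h1 h3] at h4
  exact h4

theorem Pend.deg3 [Fintype V] {G : SimpleGraph V} (h : Ctx G) {b' f g x : V} (b'f : G.Adj b' f)
    (b'g : G.Adj b' g) (fg : G.Adj f g) (nb' : ∀ w, G.Adj b' w ↔ w = x ∨ w = f ∨ w = g)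
    (xf : x ≠ f) (xg : x ≠ g)
    {C : Sym2 V → ℕ} (hC : LI G C)
    (h3 : C s(b', f) ≠ C s(f, g)) (h4 : C s(b', g) ≠ C s(f, g)) :
    (∃ f', f' ≠ b' ∧ f' ≠ g ∧ ∀ w, G.Adj f w ↔ w = b' ∨ w = g ∨ w = f') ∧
    (∃ g', g' ≠ b' ∧ g' ≠ f ∧ ∀ w, G.Adj g w ↔ w = b' ∨ w = f ∨ w = g') := by
  have key : ∀ {f g : V}, G.Adj b' f → G.Adj b' g → G.Adj f g →
      (∀ w, G.Adj f w ↔ w = b' ∨ w = g) ∨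
      (∃ f', f' ≠ b' ∧ f' ≠ g ∧ ∀ w, G.Adj f w ↔ w = b' ∨ w = g ∨ w = f') := by
    intro f g b'f b'g fg
    by_cases hf : ∃ f', f' ≠ b' ∧ f' ≠ g ∧ G.Adj f f'
    · obtain ⟨f', k1, k2, k3⟩ := hf
      exact Or.inr ⟨f', k1, k2, nb_le3 (h.deg f) b'f.symm fg k3 b'g.ne k1.symm k2.symm⟩
    · left
      intro w
      constructor
      · intro hw
        by_contra hn
        simp only [not_or] at hn
        exact hf ⟨w, hn.1, hn.2, hw⟩
      · rintro (rfl | rfl)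
        · exact b'f.symm
        · exact fg
  rcases key b'f b'g fg with k1 | k1
  · rcases key b'g b'f fg.symm with k2 | k2
    · exfalso
      have hE := hC f g fg
      rw [cd2 b'g.ne k1, cd2 b'f.ne k2, Sym2.eq_swap (a := f) (b := b'),
        Sym2.eq_swap (a := g) (b := b'), Sym2.eq_swap (a := g) (b := f)] at hE
      simp [h3, h4] at hE
    · exfalso
      obtain ⟨g', g1, g2, ng⟩ := k2
      exact S1A h k1 (b := b') (c := g) (b' := x) (c' := g') (by intro w; rw [nb' w]; tauto)
        (by intro w; rw [ng w]; tauto) xf xg g2 g1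
  · rcases key b'g b'f fg.symm with k2 | k2
    · exfalso
      obtain ⟨f', f1, f2, nf⟩ := k1
      exact S1A h k2 (b := b') (c := f) (b' := x) (c' := f') (by intro w; rw [nb' w]; tauto)
        (by intro w; rw [nf w]; tauto) xg xf f2 f1
    · exact ⟨k1, k2⟩

theorem S1B [Fintype V] {G : SimpleGraph V} (h : Ctx G) {a b c b' : V} (t : Pend G a b c b') :
    False := by
  have t0 := t
  obtain ⟨na, nb, nc, b'a, b'c⟩ := t
  have ab : G.Adj a b := (na _).2 (by simp)
  have ac : G.Adj a c := (na _).2 (by simp)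
  have bc : G.Adj b c := (nb _).2 (by simp)
  have bb' : G.Adj b b' := (nb _).2 (by simp)
  have sym : ∀ u v, G.Adj u v → G.Adj v u := fun u v h => h.symm
  have irr : ∀ u v, G.Adj u v → u ≠ v := fun u v h => h.ne
  have dab := ab.ne
  have dac := ac.ne
  have dbc := bc.ne
  have dbb := bb'.ne
  have hodd := odd_of_tri2 h bc na
  obtain ⟨X, mX⟩ : ∃ X : Set V, ∀ x, x ∈ X ↔ x ≠ a ∧ x ≠ b ∧ x ≠ c :=
    ⟨{a, b, c}ᶜ, by intro x; simp⟩
  have eX : ec G Set.univ = ec G X + 4 := by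
    have hu : (Set.univ : Set V) = insert a (insert c (insert b X)) := by
      ext w; simp only [Set.mem_insert_iff, mX, Set.mem_univ]; grind
    rw [hu, ec_ins G (v := a) (by simp only [Set.mem_insert_iff, mX]; grind) {b, c} (by
      intro w; simp only [Finset.mem_singleton, Finset.mem_insert, Set.mem_insert_iff, mX]; grind),
      ec_ins G (v := c) (by simp only [Set.mem_insert_iff, mX]; grind) {b} (by
      intro w; simp only [Finset.mem_singleton, Set.mem_insert_iff, mX]; grind),
      ec_ins G (v := b) (by simp only [mX]; grind) {b'} (by
      intro w; simp only [Finset.mem_singleton, mX]; grind), Finset.card_pair dbc]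
    simp
  have oX : Odd (ec G X) := by
    rw [Nat.not_even_iff] at hodd; rw [Nat.odd_iff]; omega
  by_cases hD : Dec (ind G X)
  · exact t0.B1 h mX hD
  obtain ⟨C, hC⟩ := h.dec
  have hb2 : cd G C b (C s(b, b')) = 2 := by
    have h1 := hC a b ab
    have h2 := hC a c ac
    have h3 := hC b c bc
    simp only [cd2 dbc na, cd3 dac b'a.symm b'c.symm nb, cd2 dab nc] at h1 h2 h3 ⊢
    rw [Sym2.eq_swap (a := b) (b := a)] at *
    rw [Sym2.eq_swap (a := c) (b := a)] at *
    rw [Sym2.eq_swap (a := c) (b := b)] at *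
    generalize C s(a, b) = p at *
    generalize C s(b, c) = q at *
    generalize C s(a, c) = r at *
    generalize C s(b, b') = s at *
    clear sym irr
    grind
  have hE := hC b b' bb'
  rw [hb2] at hE
  have hb's : s(b', b) = s(b, b') := Sym2.eq_swap
  have hf : ∃ f, f ≠ b ∧ G.Adj b' f ∧ C s(b', f) = C s(b, b') := by
    by_contra hno
    apply hD
    refine ⟨C, LI_restrict hC (fun _ _ h => h.1) ?_⟩
    intro v w w'
    simp only [ind_adj, mX]
    intro k1 k2 k3
    have hv : v = b' := by grind
    have hw : w' = b := by grind
    subst hv hw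
    intro k4
    exact hno ⟨w, k1.2.2.2.1, k1.1, by rw [k4, hb's]⟩
  obtain ⟨f, hfb, b'f, cf⟩ := hf
  have hg : ∃ g, g ≠ b ∧ g ≠ f ∧ G.Adj b' g ∧ C s(b', g) = C s(b, b') := by
    by_contra hno
    apply hE
    unfold cd
    rw [← Set.ncard_pair hfb]
    congr 1
    ext w
    simp only [Set.mem_ofPred_eq, Set.mem_insert_iff, Set.mem_singleton_iff]
    constructor
    · rintro (rfl | rfl)
      · exact ⟨b'f, cf⟩
      · exact ⟨bb'.symm, by rw [hb's]⟩
    · rintro ⟨k1, k2⟩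
      by_contra k3
      simp only [not_or] at k3
      exact hno ⟨w, k3.2, k3.1, k1, k2⟩
  obtain ⟨g, hgb, hgf, b'g, cg⟩ := hg
  have nb' := nb_le3 (h.deg b') bb'.symm b'f b'g hfb.symm hgb.symm hgf.symm
  have fg : G.Adj f g := by
    have := h.claw b' b f g hfb.symm hgb.symm hgf.symm bb'.symm b'f b'g
    grind
  have hs : C s(f, g) ≠ C s(b, b') := by
    intro hs
    have c3 : cd G C b' (C s(b, b')) = 3 := by
      rw [cd3 hfb.symm hgb.symm hgf.symm nb']
      simp [cf, cg, hb's]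
    have up : ∀ {u v : V}, G.Adj b' u → C s(b', u) = C s(b, b') → G.Adj u v → C s(u, v) = C s(b, b') →
        b' ≠ v → cd G C u (C s(b, b')) = 2 := by
      intro u v k1 k2 k3 k4 k5
      have e1 := hC b' u k1
      rw [k2, c3] at e1
      have e2 : cd G C u (C s(b, b')) ≤ 3 := by
        refine le_trans (Set.ncard_le_ncard ?_ (Set.toFinite _)) (h.deg u)
        intro w hw
        exact hw.1
      have e3 : 2 ≤ cd G C u (C s(b, b')) := by
        rw [← Set.ncard_pair k5]
        refine Set.ncard_le_ncard ?_ (Set.toFinite _)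
        rintro w (rfl | rfl)
        · exact ⟨k1.symm, by rw [Sym2.eq_swap]; exact k2⟩
        · exact ⟨k3, k4⟩
      omega
    have e1 := up b'f cf fg hs b'g.ne
    have e2 := up b'g cg fg.symm (by rw [Sym2.eq_swap]; exact hs) b'f.ne
    have := hC f g fg
    rw [hs, e1, e2] at this
    exact this rfl
  obtain ⟨⟨f', f1, f2, nf⟩, ⟨g', g1, g2, ng⟩⟩ := Pend.deg3 h b'f b'g fg nb' hfb.symm hgb.symm hC
    (by rw [cf]; exact hs.symm) (by rw [cg]; exact hs.symm)
  exact t0.B3 h mX oX nb' nf ng f1 f2 g1 g2 hC (by rw [cf]; exact hs.symm) (by rw [cg]; exact hs.symm)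

theorem S1C [Fintype V] {G : SimpleGraph V} (h : Ctx G) {a b c : V}
    (na : ∀ w, G.Adj a w ↔ w = b ∨ w = c) (nb : ∀ w, G.Adj b w ↔ w = a ∨ w = c)
    (nc : ∀ w, G.Adj c w ↔ w = a ∨ w = b) : False := by
  have ab : G.Adj a b := (na _).2 (by simp)
  have ac : G.Adj a c := (na _).2 (by simp)
  have bc : G.Adj b c := (nb _).2 (by simp)
  have dab := ab.ne
  have dac := ac.ne
  have dbc := bc.ne
  obtain ⟨C, hC⟩ := h.dec
  have h1 := hC a b ab
  have h2 := hC a c ac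
  have h3 := hC b c bc
  simp only [cd2 dbc na, cd2 dac nb, cd2 dab nc] at h1 h2 h3
  rw [Sym2.eq_swap (a := b) (b := a)] at *
  rw [Sym2.eq_swap (a := c) (b := a)] at *
  rw [Sym2.eq_swap (a := c) (b := b)] at *
  generalize C s(a, b) = p at *
  generalize C s(b, c) = q at *
  generalize C s(a, c) = r at *
  grind

theorem third [Finite V] {G : SimpleGraph V} (h : Ctx G) {a b c : V} (ab : G.Adj a b)
    (ac : G.Adj a c) (bc : b ≠ c) : (∀ w, G.Adj a w ↔ w = b ∨ w = c) ∨
      ∃ d, d ≠ b ∧ d ≠ c ∧ ∀ w, G.Adj a w ↔ w = b ∨ w = c ∨ w = d := by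
  by_cases hd : ∃ d, d ≠ b ∧ d ≠ c ∧ G.Adj a d
  · obtain ⟨d, h1, h2, h3⟩ := hd
    exact Or.inr ⟨d, h1, h2, nb_le3 (h.deg a) ab ac h3 bc h1.symm h2.symm⟩
  · left
    intro w
    constructor
    · intro hw
      by_contra hn
      simp only [not_or] at hn
      exact hd ⟨w, hn.1, hn.2, hw⟩
    · rintro (rfl | rfl) <;> assumption

theorem S1 [Fintype V] {G : SimpleGraph V} (h : Ctx G) {a b c : V} (bc : G.Adj b c)
    (na : ∀ w, G.Adj a w ↔ w = b ∨ w = c) : False := by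
  have ab : G.Adj a b := (na _).2 (by simp)
  have ac : G.Adj a c := (na _).2 (by simp)
  rcases third h ab.symm bc ac.ne with nb | ⟨b', b1, b2, nb⟩
  · rcases third h ac.symm bc.symm ab.ne with nc | ⟨c', c1, c2, nc⟩
    · exact S1C h na nb nc
    · refine S1B h (a := a) (b := c) (c := b) (b' := c') ⟨?_, nc, nb, c1, c2⟩
      intro w; rw [na w]; tauto
  · rcases third h ac.symm bc.symm ab.ne with nc | ⟨c', c1, c2, nc⟩
    · exact S1B h ⟨na, nb, nc, b1, b2⟩
    · exact S1A h na nb nc b1 b2 c1 c2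

structure Px (G : SimpleGraph V) (a b c x b' c' : V) : Prop where
  na : ∀ w, G.Adj a w ↔ w = b ∨ w = c ∨ w = x
  nx : ∀ w, G.Adj x w ↔ w = a
  nb : ∀ w, G.Adj b w ↔ w = a ∨ w = c ∨ w = b'
  nc : ∀ w, G.Adj c w ↔ w = a ∨ w = b ∨ w = c'
  b'a : b' ≠ a
  b'c : b' ≠ c
  c'a : c' ≠ a
  c'b : c' ≠ b
  xb : x ≠ b
  xc : x ≠ c
  ab : G.Adj a b
  ac : G.Adj a c
  bc : G.Adj b c
  ax : G.Adj a x
  bb' : G.Adj b b'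
  cc' : G.Adj c c'
  b'x : b' ≠ x
  c'x : c' ≠ x
  sym : ∀ u v, G.Adj u v → G.Adj v u
  irr : ∀ u v, G.Adj u v → u ≠ v

theorem Px.even [Fintype V] {G : SimpleGraph V} (h : Ctx G) {a b c x b' c' : V}
    (t : Px G a b c x b' c') : Even (ec G Set.univ) := by
  obtain ⟨na, nx, nb, nc, b'a, b'c, c'a, c'b, xb, xc, ab, ac, bc, ax, bb', cc', b'x, c'x, sym, irr⟩ := t
  have dab := ab.ne
  have dac := ac.ne
  have dbc := bc.ne
  have dax := ax.ne
  by_contra hodd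
  have hR : RC G (Set.univ \ {x}) b := by
    apply (RC_univ h.conn b).simp xb.symm
    grind
  have hR2 : RC G ((Set.univ \ {x}) \ {a}) b := by
    apply hR.simp dab.symm
    simp only [Set.mem_sdiff, Set.mem_univ, true_and, Set.mem_singleton_iff]
    grind
  have mS : ∀ w, w ∈ ((Set.univ \ {x}) \ {a} : Set V) ↔ w ≠ x ∧ w ≠ a := by intro w; simp
  generalize ((Set.univ \ {x}) \ {a} : Set V) = S at *
  have hu : (Set.univ : Set V) = insert x (insert a S) := by
    ext w; simp only [Set.mem_insert_iff, mS, Set.mem_univ]; grind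
  rw [hu, ec_ins G (v := x) (by simp only [Set.mem_insert_iff, mS]; grind) {a} (by
      intro w; simp only [Finset.mem_singleton, Set.mem_insert_iff, mS]; grind),
      ec_ins G (v := a) (by simp only [mS]; grind) {b, c} (by
      intro w; simp only [Finset.mem_singleton, Finset.mem_insert, mS]; grind), Finset.card_pair dbc,
      Finset.card_singleton, Nat.not_even_iff] at hodd
  refine starA h ab ac bc S (by rw [mS]; grind) ?_ ?_ (hR2.dec ?_)
  · intro u v; simp only [mS]; grind
  · intro w; simp only [mS]; grind
  · rw [Nat.even_iff]; omega

/-- common neighbour -/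
theorem Px.alpha [Fintype V] {G : SimpleGraph V} (h : Ctx G) {a b c x b' : V}
    (t : Px G a b c x b' b') {T : Set V} (mT : ∀ w, w ∈ T ↔ w ≠ a ∧ w ≠ b ∧ w ≠ c ∧ w ≠ x)
    (hT : RC G T b') : False := by
  have hev := t.even h
  obtain ⟨na, nx, nb, nc, b'a, b'c, c'a, c'b, xb, xc, ab, ac, bc, ax, bb', cc', b'x, c'x, sym, irr⟩ := t
  have dab := ab.ne
  have dac := ac.ne
  have dbc := bc.ne
  have dax := ax.ne
  have hu : (Set.univ : Set V) = insert x (insert a (insert b (insert c T))) := by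
    ext w; simp only [Set.mem_insert_iff, mT, Set.mem_univ]; grind
  rw [hu, ec_ins G (v := x) (by simp only [Set.mem_insert_iff, mT]; grind) {a} (by
      intro w; simp only [Finset.mem_singleton, Set.mem_insert_iff, mT]; grind),
      ec_ins G (v := a) (by simp only [Set.mem_insert_iff, mT]; grind) {b, c} (by
      intro w; simp only [Finset.mem_singleton, Finset.mem_insert, Set.mem_insert_iff, mT]; grind),
      ec_ins G (v := b) (by simp only [Set.mem_insert_iff, mT]; grind) {c, b'} (by
      intro w; simp only [Finset.mem_singleton, Finset.mem_insert, Set.mem_insert_iff, mT]; grind),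
      ec_ins G (v := c) (by simp only [mT]; grind) {b'} (by
      intro w; simp only [Finset.mem_singleton, mT]; grind),
      Finset.card_pair dbc, Finset.card_pair b'c.symm,
      Finset.card_singleton, Finset.card_singleton, Nat.even_iff] at hev
  have hD := hT.dec (by rw [Nat.even_iff]; omega)
  obtain ⟨c1, hc1⟩ := h.min _ hD ⟨a, b, ab, by rw [mT]; grind⟩
  obtain ⟨d, hd⟩ := nb_le2 (h.deg b') bb'.symm cc'.symm dbc
  obtain ⟨j3, j31, _⟩ := fin3_avoid (c1 s(b', d)) (c1 s(b', d))
  obtain ⟨j1, j11, _⟩ := fin3_avoid j3 j3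
  obtain ⟨j2, j21, j22⟩ := fin3_avoid j3 j1
  obtain ⟨c2, hc2, _, hC2⟩ := glue (G := ind G (insert b (insert c T)) \ stG G b {c})
    (H₁ := ind G T) (H₂ := stG G b' {b, c}) (κ := Fin 3) (by
      intro u v
      simp only [ind_adj, SimpleGraph.sdiff_adj, stG_adj, mT, Set.mem_insert_iff, Set.mem_singleton_iff]
      grind) (by
      intro u v
      simp only [ind_adj, stG_adj, mT, Set.mem_insert_iff, Set.mem_singleton_iff]
      grind) hc1 (LI_star (p := b) (q := c) (by simp) (by simp) dbc bb'.symm cc'.symm j3) (by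
      intro v w w'
      simp only [ind_adj, stG_adj, mT, Set.mem_insert_iff, Set.mem_singleton_iff]
      intro h1 h2
      have hv : v = b' := by grind
      subst hv
      have : w = d := by grind
      subst this
      exact j31.symm)
  obtain ⟨c3, hc3, hC3, hC3'⟩ := glue (G := stG G a {x, b} ⊔ stG G c {a, b})
    (H₁ := stG G a {x, b}) (H₂ := stG G c {a, b}) (κ := Fin 3) (fun u v => Iff.rfl) (by
      intro u v
      simp only [stG_adj, Set.mem_insert_iff, Set.mem_singleton_iff]
      grind) (LI_star (p := x) (q := b) (by simp) (by simp) xb ax ab j1)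
      (LI_star (p := a) (q := b) (by simp) (by simp) dab ac.symm bc.symm j2) (by
      intro v w w' _ _
      exact j22.symm)
  have hv3 : ∀ u v, (stG G a {x, b} ⊔ stG G c {a, b}).Adj u v → c3 s(u, v) ≠ j3 := by
    intro u v huv
    rcases huv with huv | huv
    · rw [hC3 _ _ huv]; exact j11
    · rw [hC3' _ _ huv]; exact j21
  obtain ⟨D, hD, _⟩ := glue (G := G) (H₁ := ind G (insert b (insert c T)) \ stG G b {c})
    (H₂ := stG G a {x, b} ⊔ stG G c {a, b}) (κ := Fin 3) (by
      intro u v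
      simp only [ind_adj, SimpleGraph.sup_adj, SimpleGraph.sdiff_adj, stG_adj, mT, Set.mem_insert_iff, Set.mem_singleton_iff]
      grind) (by
      intro u v
      simp only [ind_adj, SimpleGraph.sup_adj, SimpleGraph.sdiff_adj, stG_adj, mT, Set.mem_insert_iff, Set.mem_singleton_iff]
      grind) hc2 hc3 (by
      intro v w w' h1 h2
      have h3 := hv3 _ _ h2
      have h4 : (stG G b' {b, c}).Adj v w := by
        clear h3 hC2 hC3 hC3' hv3 hc1 hc2 hc3 j31
        simp only [ind_adj, SimpleGraph.sup_adj, SimpleGraph.sdiff_adj, stG_adj, mT, Set.mem_insert_iff, Set.mem_singleton_iff] at *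
        grind
      rw [hC2 _ _ h4]
      exact h3.symm)
  exact h.ncol ⟨D, hD⟩

theorem Px.beta1 [Fintype V] {G : SimpleGraph V} (h : Ctx G) {a b c x b' c' f g : V}
    (t : Px G a b c x b' c') {U : Set V}
    (mU : ∀ w, w ∈ U ↔ (w ≠ a ∧ w ≠ b ∧ w ≠ c ∧ w ≠ x) ∧ w ≠ b')
    (hU : RC G U c') (hbc : b' ≠ c') (hf : f ∈ U) (hg : g ∈ U) (hfg : f ≠ g) (b'f : G.Adj b' f)
    (b'g : G.Adj b' g) : False := by
  have hev := t.even h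
  obtain ⟨na, nx, nb, nc, b'a, b'c, c'a, c'b, xb, xc, ab, ac, bc, ax, bb', cc', b'x, c'x, sym, irr⟩ := t
  have dab := ab.ne
  have dac := ac.ne
  have dbc := bc.ne
  have dax := ax.ne
  have dcc := cc'.ne
  have dbb := bb'.ne
  have c'U : c' ∈ U := by rw [mU]; grind
  have hS : RC G (insert b (insert c U)) c' := (hU.insert c'U cc').insert (Set.mem_insert _ _) bc
  rw [mU] at hf hg
  have nb' := nb_le3 (h.deg b') bb'.symm b'f b'g (Ne.symm hf.1.2.1) (Ne.symm hg.1.2.1) hfg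
  have mS : ∀ w, w ∈ insert b (insert c U) ↔ w ≠ a ∧ w ≠ x ∧ w ≠ b' := by
    intro w; simp only [Set.mem_insert_iff, mU]; grind
  generalize insert b (insert c U) = S at *
  have hu : (Set.univ : Set V) = insert x (insert a (insert b' S)) := by
    ext w; simp only [Set.mem_insert_iff, mS, Set.mem_univ]; grind
  have h3 : ({b, f, g} : Finset V).card = 3 := by
    rw [Finset.card_eq_three]; exact ⟨b, f, g, Ne.symm hf.1.2.1, Ne.symm hg.1.2.1, hfg, rfl⟩
  rw [hu, ec_ins G (v := x) (by simp only [Set.mem_insert_iff, mS]; grind) {a} (by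
      intro w; simp only [Finset.mem_singleton, Set.mem_insert_iff, mS]; grind),
      ec_ins G (v := a) (by simp only [Set.mem_insert_iff, mS]; grind) {b, c} (by
      intro w; simp only [Finset.mem_singleton, Finset.mem_insert, Set.mem_insert_iff, mS]; grind),
      ec_ins G (v := b') (by simp only [mS]; grind) {b, f, g} (by
      intro w; simp only [Finset.mem_singleton, Finset.mem_insert, mS]; grind), h3,
      Finset.card_pair dbc, Finset.card_singleton, Nat.even_iff] at hev
  have hD := hS.dec (by rw [Nat.even_iff]; omega)
  refine starA h ab ac bc (insert b' S) (by simp only [Set.mem_insert_iff, mS]; grind) ?_ ?_ ?_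
  · intro u v; simp only [Set.mem_insert_iff, mS]; grind
  · intro w; simp only [Set.mem_insert_iff, mS]; grind
  · refine Dec.union (H₁ := ind G S) (H₂ := stG G b' {b, f, g}) ?_ ?_ hD
      (Dec.star (p := f) (q := g) (by simp) (by simp) hfg b'f b'g)
    · intro u v
      simp only [ind_adj, stG_adj, mS, Set.mem_insert_iff, Set.mem_singleton_iff]
      clear hS hev hD
      constructor
      · rintro ⟨h1, h2, h3⟩
        by_cases hu : u = b'
        · grind
        by_cases hv : v = b'
        · grind
        grind
      · grind
    · intro u v
      simp only [ind_adj, stG_adj, mS, Set.mem_insert_iff, Set.mem_singleton_iff]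
      grind

theorem Px.beta2 [Fintype V] {G : SimpleGraph V} (h : Ctx G) {a b c x b' c' f : V}
    (t : Px G a b c x b' c') {U : Set V}
    (mU : ∀ w, w ∈ U ↔ (w ≠ a ∧ w ≠ b ∧ w ≠ c ∧ w ≠ x) ∧ w ≠ b')
    (hU : RC G U c') (hbc : b' ≠ c') (hf : f ∈ U)
    (nb' : ∀ w, G.Adj b' w ↔ w = b ∨ w = f) : False := by
  have hev := t.even h
  obtain ⟨na, nx, nb, nc, b'a, b'c, c'a, c'b, xb, xc, ab, ac, bc, ax, bb', cc', b'x, c'x, sym, irr⟩ := t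
  have dab := ab.ne
  have dac := ac.ne
  have dbc := bc.ne
  have dax := ax.ne
  have dcc := cc'.ne
  have dbb := bb'.ne
  have c'U : c' ∈ U := by rw [mU]; grind
  have hS : RC G (insert c U) c' := hU.insert c'U cc'
  rw [mU] at hf
  have b'f : G.Adj b' f := (nb' f).2 (by simp)
  have mS : ∀ w, w ∈ insert c U ↔ w ≠ a ∧ w ≠ x ∧ w ≠ b' ∧ w ≠ b := by
    intro w; simp only [Set.mem_insert_iff, mU]; grind
  generalize insert c U = S at *
  have hu : (Set.univ : Set V) = insert x (insert a (insert b (insert b' S))) := by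
    ext w; simp only [Set.mem_insert_iff, mS, Set.mem_univ]; grind
  rw [hu, ec_ins G (v := x) (by simp only [Set.mem_insert_iff, mS]; grind) {a} (by
      intro w; simp only [Finset.mem_singleton, Set.mem_insert_iff, mS]; grind),
      ec_ins G (v := a) (by simp only [Set.mem_insert_iff, mS]; grind) {b, c} (by
      intro w; simp only [Finset.mem_singleton, Finset.mem_insert, Set.mem_insert_iff, mS]; grind),
      ec_ins G (v := b) (by simp only [Set.mem_insert_iff, mS]; grind) {c, b'} (by
      intro w; simp only [Finset.mem_singleton, Finset.mem_insert, Set.mem_insert_iff, mS]; grind),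
      ec_ins G (v := b') (by simp only [mS]; grind) {f} (by
      intro w; simp only [Finset.mem_singleton, mS]; grind),
      Finset.card_pair dbc, Finset.card_pair b'c.symm,
      Finset.card_singleton, Finset.card_singleton, Nat.even_iff] at hev
  have hD := hS.dec (by rw [Nat.even_iff]; omega)
  obtain ⟨c1, hc1⟩ := h.min _ hD ⟨a, b, ab, by rw [mS]; grind⟩
  obtain ⟨p1, p2, hp⟩ := nb_le (h.deg f) b'f.symm
  obtain ⟨p, hp1, hp2⟩ := fin3_avoid (c1 s(f, p1)) (c1 s(f, p2))
  obtain ⟨s, hs1, hs2⟩ := fin3_avoid p (c1 s(c, c'))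
  obtain ⟨t, ht1, ht2⟩ := fin3_avoid s (c1 s(c, c'))
  obtain ⟨c2, hc2, hC2, hC2'⟩ := glue (G := stG G a {x, c} ⊔ stG G b {a, c})
    (H₁ := stG G a {x, c}) (H₂ := stG G b {a, c}) (κ := Fin 3) (fun u v => Iff.rfl) (by
      intro u v
      simp only [stG_adj, Set.mem_insert_iff, Set.mem_singleton_iff]
      grind) (LI_star (p := x) (q := c) (by simp) (by simp) xc ax ac t)
      (LI_star (p := a) (q := c) (by simp) (by simp) dac ab.symm bc s) (by
      intro v w w' _ _
      exact ht1)
  obtain ⟨c3, hc3, hC3, hC3'⟩ := glue (G := (stG G a {x, c} ⊔ stG G b {a, c}) ⊔ stG G b' {b, f})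
    (H₁ := stG G a {x, c} ⊔ stG G b {a, c}) (H₂ := stG G b' {b, f}) (κ := Fin 3)
    (fun u v => Iff.rfl) (by
      intro u v
      simp only [SimpleGraph.sup_adj, stG_adj, Set.mem_insert_iff, Set.mem_singleton_iff]
      grind) hc2 (LI_star (p := b) (q := f) (by simp) (by simp) (Ne.symm hf.1.2.1) bb'.symm b'f p) (by
      intro v w w' h1 h2
      have h4 : (stG G b {a, c}).Adj v w := by
        clear hC2 hC2' hc1 hc2 hs1 hs2 ht1 ht2 hp1 hp2
        simp only [SimpleGraph.sup_adj, stG_adj, Set.mem_insert_iff, Set.mem_singleton_iff] at *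
        grind
      rw [hC2' _ _ h4]
      exact hs1)
  have val1 : ∀ w, (w = a ∨ w = b) → c3 s(c, w) ≠ c1 s(c, c') := by
    rintro w (rfl | rfl)
    · have h1 : (stG G w {x, c}).Adj c w := by
        simp only [stG_adj, Set.mem_insert_iff, Set.mem_singleton_iff]; grind
      rw [hC3 _ _ (Or.inl h1), hC2 _ _ h1]; exact ht2
    · have h1 : (stG G w {a, c}).Adj c w := by
        simp only [stG_adj, Set.mem_insert_iff, Set.mem_singleton_iff]; grind
      rw [hC3 _ _ (Or.inr h1), hC2' _ _ h1]; exact hs2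
  have val2 : c3 s(f, b') = p := by
    rw [hC3' _ _ (by simp only [stG_adj, Set.mem_insert_iff, Set.mem_singleton_iff]; grind)]
  clear hC3 hC3' hC2 hC2' hc2
  obtain ⟨D, hD, _⟩ := glue (G := G) (H₁ := ind G S)
    (H₂ := (stG G a {x, c} ⊔ stG G b {a, c}) ⊔ stG G b' {b, f}) (κ := Fin 3) (by
      intro u v
      simp only [ind_adj, SimpleGraph.sup_adj, stG_adj, mS, Set.mem_insert_iff, Set.mem_singleton_iff]
      clear val1 val2 hp1 hp2 hs1 hs2 ht1 ht2 hev hc1 hc3 hS hD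
      constructor
      · intro h1
        by_cases hu : u = a
        · grind
        by_cases hv : v = a
        · grind
        by_cases hu : u = b'
        · grind
        by_cases hv : v = b'
        · grind
        by_cases hu : u = b
        · grind
        by_cases hv : v = b
        · grind
        grind
      · grind) (by
      intro u v
      simp only [ind_adj, SimpleGraph.sup_adj, stG_adj, mS, Set.mem_insert_iff, Set.mem_singleton_iff]
      clear val1 val2 hp1 hp2 hs1 hs2 ht1 ht2 hev hc1 hc3 hS hD
      grind) hc1 hc3 (by
      intro v w w' h1 h2
      have h4 : (v = c ∧ w = c' ∧ (w' = a ∨ w' = b)) ∨ (v = f ∧ w' = b') := by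
        clear val1 val2 hp1 hp2 hs1 hs2 ht1 ht2 hev hc1 hc3 hS hD
        simp only [ind_adj, SimpleGraph.sup_adj, stG_adj, mS, Set.mem_insert_iff, Set.mem_singleton_iff] at *
        grind
      rcases h4 with ⟨rfl, rfl, h4⟩ | ⟨rfl, rfl⟩
      · exact (val1 _ h4).symm
      · rw [val2]
        have h5 := h1.2.2
        rw [mS] at h5
        rcases hp w h1.1 with rfl | rfl | rfl
        · grind
        · exact hp1.symm
        · exact hp2.symm)
  exact h.ncol ⟨D, hD⟩

theorem Px.beta [Fintype V] {G : SimpleGraph V} (h : Ctx G) {a b c x b' c' : V}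
    (t : Px G a b c x b' c') {T : Set V} (mT : ∀ w, w ∈ T ↔ w ≠ a ∧ w ≠ b ∧ w ≠ c ∧ w ≠ x)
    (hT : RC G T c') (hbc : b' ≠ c') : False := by
  have hU : RC G (T \ {b'}) c' := by
    apply hT.simp hbc.symm
    intro u hu v hv h1 h2
    by_contra hno
    rw [not_or] at hno
    rw [mT] at hu hv
    have d1 := h1.ne
    have d2 := h2.ne
    have := t.nb u
    have := t.nb v
    rcases h.claw b' b u v (by grind) (by grind) hno.1 t.bb'.symm h1 h2 with h3 | h3 | h3 <;> grind
  have mU : ∀ w, w ∈ T \ {b'} ↔ (w ≠ a ∧ w ≠ b ∧ w ≠ c ∧ w ≠ x) ∧ w ≠ b' := by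
    intro w; rw [Set.mem_sdiff, mT, Set.mem_singleton_iff]
  have b'T : b' ∈ T := by
    rw [mT]; exact ⟨t.b'a, t.bb'.ne.symm, t.b'c, t.b'x⟩
  obtain ⟨f, hf, b'f⟩ : ∃ f ∈ T \ {b'}, G.Adj b' f := by
    obtain ⟨q⟩ := (hT b' b'T).symm
    cases q with
    | nil => exact absurd rfl hbc
    | cons h1 q => exact ⟨_, ⟨h1.2.2, h1.1.ne.symm⟩, h1.1⟩
  rcases third h t.bb'.symm b'f (by rintro rfl; rw [mU] at hf; exact hf.1.2.1 rfl) with h1 | ⟨g, g1, g2, h1⟩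
  · exact t.beta2 h mU hU hbc hf h1
  · have b'g : G.Adj b' g := (h1 g).2 (by simp)
    refine t.beta1 h mU hU hbc hf ?_ g2.symm b'f b'g
    have d := b'g.ne
    have e1 := t.na b'
    have e2 := t.nc b'
    have e3 := t.nx b'
    have e4 := b'g.symm
    have := t.b'a
    have := t.b'c
    have := t.b'x
    have := t.bb'.ne
    rw [mU]
    grind

structure Sp (G : SimpleGraph V) (a b c x b' c' : V) (X Y : Set V) : Prop where
  b'X : b' ∈ X
  c'Y : c' ∈ Y
  dXY : ∀ v ∈ X, v ∉ Y
  cov : ∀ v, v = a ∨ v = b ∨ v = c ∨ v = x ∨ v ∈ X ∨ v ∈ Y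
  aX : a ∉ X
  bX : b ∉ X
  cX : c ∉ X
  xX : x ∉ X
  aY : a ∉ Y
  bY : b ∉ Y
  cY : c ∉ Y
  xY : x ∉ Y
  clX : ∀ u v, u ∈ X → G.Adj u v → v ∈ X ∨ (u = b' ∧ v = b)
  clY : ∀ u v, u ∈ Y → G.Adj u v → v ∈ Y ∨ (u = c' ∧ v = c)
  rX : RC G X b'
  rY : RC G Y c'

theorem Px.ecUniv [Fintype V] {G : SimpleGraph V} {a b c x b' c' : V}
    (t : Px G a b c x b' c') {X Y : Set V} (s : Sp G a b c x b' c' X Y) :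
    ec G Set.univ = ec G X + ec G Y + 6 := by
  obtain ⟨na, nx, nb, nc, b'a, b'c, c'a, c'b, xb, xc, ab, ac, bc, ax, bb', cc', b'x, c'x, sym, irr⟩ := t
  obtain ⟨b'X, c'Y, dXY, cov, aX, bX, cX, xX, aY, bY, cY, xY, clX, clY, rX, rY⟩ := s
  have dab := ab.ne
  have dac := ac.ne
  have dbc := bc.ne
  have dax := ax.ne
  rw [← Nat.add_zero 6]
  have hu : (Set.univ : Set V) = insert x (insert a (insert b (insert c (X ∪ Y)))) := by
    ext w; simp only [Set.mem_insert_iff, Set.mem_union, Set.mem_univ]; grind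
  rw [hu, ec_ins G (v := x) (by simp only [Set.mem_insert_iff, Set.mem_union]; grind) {a} (by
      intro w; simp only [Finset.mem_singleton, Set.mem_insert_iff, Set.mem_union]; grind),
      ec_ins G (v := a) (by simp only [Set.mem_insert_iff, Set.mem_union]; grind) {b, c} (by
      intro w; simp only [Finset.mem_singleton, Finset.mem_insert, Set.mem_insert_iff, Set.mem_union]; grind),
      ec_ins G (v := b) (by simp only [Set.mem_insert_iff, Set.mem_union]; grind) {c, b'} (by
      intro w; simp only [Finset.mem_singleton, Finset.mem_insert, Set.mem_insert_iff, Set.mem_union]; grind),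
      ec_ins G (v := c) (by simp only [Set.mem_union]; grind) {c'} (by
      intro w; simp only [Finset.mem_singleton, Set.mem_union]; grind),
      Finset.card_pair dbc, Finset.card_pair b'c.symm,
      Finset.card_singleton, Finset.card_singleton, ec_union G dXY (by grind)]

theorem Px.gamma1 [Fintype V] {G : SimpleGraph V} (h : Ctx G) {a b c x b' c' : V}
    (t : Px G a b c x b' c') {X Y : Set V} (s : Sp G a b c x b' c' X Y)
    (eX : ec G X % 2 = 0) (eY : ec G Y % 2 = 0) : False := by
  obtain ⟨na, nx, nb, nc, b'a, b'c, c'a, c'b, xb, xc, ab, ac, bc, ax, bb', cc', b'x, c'x, sym, irr⟩ := t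
  obtain ⟨b'X, c'Y, dXY, cov, aX, bX, cX, xX, aY, bY, cY, xY, clX, clY, rX, rY⟩ := s
  have dab := ab.ne
  have dac := ac.ne
  have dbc := bc.ne
  have dax := ax.ne
  have rA := (rX.insert b'X bb').insert (Set.mem_insert _ _) bc.symm
  have rB := (rY.insert c'Y cc').insert (Set.mem_insert _ _) ac
  have eA : Even (ec G (insert c (insert b X))) := by
    rw [ec_ins G (v := c) (by simp only [Set.mem_insert_iff]; grind) {b} (by
      intro w; simp only [Finset.mem_singleton, Set.mem_insert_iff]; grind),
      ec_ins G (v := b) bX {b'} (by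
      intro w; simp only [Finset.mem_singleton]; grind), Finset.card_singleton, Finset.card_singleton,
      Nat.even_iff]; omega
  have eB : Even (ec G (insert a (insert c Y))) := by
    rw [ec_ins G (v := a) (by simp only [Set.mem_insert_iff]; grind) {c} (by
      intro w; simp only [Finset.mem_singleton, Set.mem_insert_iff]; grind),
      ec_ins G (v := c) cY {c'} (by
      intro w; simp only [Finset.mem_singleton]; grind), Finset.card_singleton, Finset.card_singleton,
      Nat.even_iff]; omega
  have dA := rA.dec eA
  have dB := rB.dec eB
  have mA : ∀ w, w ∈ insert c (insert b X) ↔ w = c ∨ w = b ∨ w ∈ X := by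
    intro w; simp only [Set.mem_insert_iff]
  have mB : ∀ w, w ∈ insert a (insert c Y) ↔ w = a ∨ w = c ∨ w ∈ Y := by
    intro w; simp only [Set.mem_insert_iff]
  clear rA rB eA eB rX rY
  generalize insert c (insert b X) = A at *
  generalize insert a (insert c Y) = B at *
  obtain ⟨c1, hc1, v1⟩ := (h.min _ dA ⟨x, a, ax.symm, by rw [mA]; grind⟩).fix s(c, b) 0
  obtain ⟨c2, hc2, v2⟩ := (h.min _ dB ⟨x, a, ax.symm, by rw [mB]; grind⟩).fix s(a, c) 1
  have w1 : c1 s(b, b') = 0 := by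
    rw [← v1]
    apply leaf_color hc1 b'c.symm
    · intro w; rw [ind_adj, mA, mA]; grind
    · intro w; rw [ind_adj, mA, mA]; grind
  have w2 : c2 s(c, c') = 1 := by
    rw [← v2]
    apply leaf_color hc2 c'a.symm
    · intro w; rw [ind_adj, mB, mB]; grind
    · intro w; rw [ind_adj, mB, mB]; grind
  have v1' : c1 s(b, c) = 0 := by rw [Sym2.eq_swap]; exact v1
  have v2' : c2 s(c, a) = 1 := by rw [Sym2.eq_swap]; exact v2
  obtain ⟨c3, hc3, hC3, hC3'⟩ := glue (G := ind G A ⊔ ind G B)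
    (H₁ := ind G A) (H₂ := ind G B) (κ := Fin 3) (fun u v => Iff.rfl) (by
      intro u v
      rw [ind_adj, ind_adj, mA, mA, mB, mB]
      clear v1 v2 w1 w2 v1' v2'
      grind) hc1 hc2 (by
      intro v w w' h1 h2
      have h3 : v = c ∧ w = b ∧ (w' = a ∨ w' = c') := by
        rw [ind_adj, mA, mA] at h1
        rw [ind_adj, mB, mB] at h2
        clear v1 v2 w1 w2 v1' v2'
        grind
      obtain ⟨rfl, rfl, rfl | rfl⟩ := h3
      · rw [v1, v2']; decide
      · rw [v1, w2]; decide)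
  have u1 : ∀ w, (w = c ∨ w = b') → c3 s(b, w) = 0 := by
    rintro w (rfl | rfl)
    · rw [hC3 _ _ (by rw [ind_adj, mA, mA]; simp [bc]), v1']
    · rw [hC3 _ _ (by rw [ind_adj, mA, mA]; simp [bb', b'X]), w1]
  have u2 : c3 s(a, c) = 1 := by
    rw [hC3' _ _ (by rw [ind_adj, mB, mB]; simp [ac]), v2]
  clear hC3 hC3' v1 v2 w1 w2 v1' v2' hc1 hc2
  obtain ⟨D, hD, _⟩ := glue (G := G) (H₁ := ind G A ⊔ ind G B) (H₂ := stG G a {x, b}) (κ := Fin 3) (by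
      intro u v
      simp only [ind_adj, SimpleGraph.sup_adj, stG_adj, mA, mB, Set.mem_insert_iff, Set.mem_singleton_iff]
      clear u1 u2 hc3 dA dB eX eY
      constructor
      · intro h1
        rcases cov u with h | h | h | h | h | h <;> grind
      · grind) (by
      intro u v
      simp only [ind_adj, SimpleGraph.sup_adj, stG_adj, mA, mB, Set.mem_insert_iff, Set.mem_singleton_iff]
      clear u1 u2 hc3 dA dB eX eY
      grind) hc3 (LI_star (p := x) (q := b) (by simp) (by simp) xb ax ab 2) (by
      intro v w w' h1 h2
      have h4 : (v = a ∧ w = c) ∨ (v = b ∧ (w = c ∨ w = b')) := by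
        clear u1 u2 hc3 dA dB eX eY
        simp only [ind_adj, SimpleGraph.sup_adj, stG_adj, mA, mB, Set.mem_insert_iff, Set.mem_singleton_iff] at *
        grind
      rcases h4 with ⟨rfl, rfl⟩ | ⟨rfl, h4⟩
      · rw [u2]; decide
      · rw [u1 _ h4]; decide)
  exact h.ncol ⟨D, hD⟩

theorem Px.gamma2 [Fintype V] {G : SimpleGraph V} (h : Ctx G) {a b c x b' c' : V}
    (t : Px G a b c x b' c') {X Y : Set V} (s : Sp G a b c x b' c' X Y)
    (eX : ec G X % 2 = 1) (eY : ec G Y % 2 = 1) : False := by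
  obtain ⟨na, nx, nb, nc, b'a, b'c, c'a, c'b, xb, xc, ab, ac, bc, ax, bb', cc', b'x, c'x, sym, irr⟩ := t
  obtain ⟨b'X, c'Y, dXY, cov, aX, bX, cX, xX, aY, bY, cY, xY, clX, clY, rX, rY⟩ := s
  have dab := ab.ne
  have dac := ac.ne
  have dbc := bc.ne
  have dax := ax.ne
  have rA := (rX.insert b'X bb')
  have rB := (rY.insert c'Y cc')
  have eA : Even (ec G (insert b X)) := by
    rw [ec_ins G (v := b) bX {b'} (by
      intro w; simp only [Finset.mem_singleton]; grind), Finset.card_singleton,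
      Nat.even_iff]; omega
  have eB : Even (ec G (insert c Y)) := by
    rw [ec_ins G (v := c) cY {c'} (by
      intro w; simp only [Finset.mem_singleton]; grind), Finset.card_singleton,
      Nat.even_iff]; omega
  have dA := rA.dec eA
  have dB := rB.dec eB
  have mA : ∀ w, w ∈ insert b X ↔ w = b ∨ w ∈ X := by
    intro w; simp only [Set.mem_insert_iff]
  have mB : ∀ w, w ∈ insert c Y ↔ w = c ∨ w ∈ Y := by
    intro w; simp only [Set.mem_insert_iff]
  clear rA rB eA eB rX rY
  generalize insert b X = A at *
  generalize insert c Y = B at *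
  obtain ⟨c1, hc1, v1⟩ := (h.min _ dA ⟨x, a, ax.symm, by rw [mA]; grind⟩).fix s(b, b') 0
  obtain ⟨c2, hc2, v2⟩ := (h.min _ dB ⟨x, a, ax.symm, by rw [mB]; grind⟩).fix s(c, c') 0
  obtain ⟨c3, hc3, hC3, hC3'⟩ := glue (G := ind G A ⊔ ind G B)
    (H₁ := ind G A) (H₂ := ind G B) (κ := Fin 3) (fun u v => Iff.rfl) (by
      intro u v
      rw [ind_adj, ind_adj, mA, mA, mB, mB]
      clear v1 v2
      grind) hc1 hc2 (by
      intro v w w' h1 h2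
      rw [ind_adj, mA, mA] at h1
      rw [ind_adj, mB, mB] at h2
      clear v1 v2
      grind)
  have u1 : c3 s(b, b') = 0 := by
    rw [hC3 _ _ (by rw [ind_adj, mA, mA]; simp [bb', b'X]), v1]
  have u2 : c3 s(c, c') = 0 := by
    rw [hC3' _ _ (by rw [ind_adj, mB, mB]; simp [cc', c'Y]), v2]
  clear hC3 hC3' v1 v2 hc1 hc2
  obtain ⟨c4, hc4, hC4, hC4'⟩ := glue (G := stG G a {x, c} ⊔ stG G b {a, c})
    (H₁ := stG G a {x, c}) (H₂ := stG G b {a, c}) (κ := Fin 3) (fun u v => Iff.rfl) (by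
      intro u v
      simp only [stG_adj, Set.mem_insert_iff, Set.mem_singleton_iff]
      clear u1 u2
      grind) (LI_star (p := x) (q := c) (by simp) (by simp) xc ax ac 2)
      (LI_star (p := a) (q := c) (by simp) (by simp) dac ab.symm bc 1) (by
      intro v w w' _ _
      decide)
  have hv4 : ∀ u v, (stG G a {x, c} ⊔ stG G b {a, c}).Adj u v → c4 s(u, v) ≠ 0 := by
    intro u v huv
    rcases huv with huv | huv
    · rw [hC4 _ _ huv]; decide
    · rw [hC4' _ _ huv]; decide
  clear hC4 hC4'
  obtain ⟨D, hD, _⟩ := glue (G := G) (H₁ := ind G A ⊔ ind G B)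
    (H₂ := stG G a {x, c} ⊔ stG G b {a, c}) (κ := Fin 3) (by
      intro u v
      simp only [ind_adj, SimpleGraph.sup_adj, stG_adj, mA, mB, Set.mem_insert_iff, Set.mem_singleton_iff]
      clear u1 u2 hc3 dA dB eX eY hv4
      constructor
      · intro h1
        rcases cov u with h | h | h | h | h | h <;> grind
      · grind) (by
      intro u v
      simp only [ind_adj, SimpleGraph.sup_adj, stG_adj, mA, mB, Set.mem_insert_iff, Set.mem_singleton_iff]
      clear u1 u2 hc3 dA dB eX eY hv4
      grind) hc3 hc4 (by
      intro v w w' h1 h2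
      have h3 := hv4 _ _ h2
      have h4 : (v = b ∧ w = b') ∨ (v = c ∧ w = c') := by
        clear u1 u2 hc3 dA dB eX eY hv4 h3
        simp only [ind_adj, SimpleGraph.sup_adj, stG_adj, mA, mB, Set.mem_insert_iff, Set.mem_singleton_iff] at *
        grind
      rcases h4 with ⟨rfl, rfl⟩ | ⟨rfl, rfl⟩
      · rw [u1]; exact h3.symm
      · rw [u2]; exact h3.symm)
  exact h.ncol ⟨D, hD⟩

theorem S2 [Fintype V] {G : SimpleGraph V} (h : Ctx G) {a b c x : V} (ab : G.Adj a b)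
    (bc : G.Adj b c) (ac : G.Adj a c) (ax : G.Adj a x) (nx : ∀ w, G.Adj x w ↔ w = a) : False := by
  have xb : x ≠ b := by rintro rfl; exact ac.ne ((nx c).1 bc).symm
  have xc : x ≠ c := by rintro rfl; exact ab.ne ((nx b).1 bc.symm).symm
  have na := nb_le3 (h.deg a) ab ac ax bc.ne xb.symm xc.symm
  rcases third h ab.symm bc ac.ne with nb | ⟨b', b1, b2, nb⟩
  · exact S1 h ac nb
  rcases third h ac.symm bc.symm ab.ne with nc | ⟨c', c1, c2, nc⟩
  · exact S1 h ab nc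
  have bb' : G.Adj b b' := (nb _).2 (by simp)
  have cc' : G.Adj c c' := (nc _).2 (by simp)
  have b'x : b' ≠ x := by rintro rfl; exact ab.ne ((nx b).1 bb'.symm).symm
  have c'x : c' ≠ x := by rintro rfl; exact ac.ne ((nx c).1 cc'.symm).symm
  have t : Px G a b c x b' c' := ⟨na, nx, nb, nc, b1, b2, c1, c2, xb, xc, ab, ac, bc, ax, bb', cc',
    b'x, c'x, fun _ _ h => h.symm, fun _ _ h => h.ne⟩
  have mK : ∀ w, w ∈ ({a, b, c, x} : Set V) ↔ w = a ∨ w = b ∨ w = c ∨ w = x := by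
    intro w; simp
  have dbb := bb'.ne
  have dcc := cc'.ne
  have hK := comps (b' := b') (c' := c') h.conn ({a, b, c, x} : Set V) (k0 := a) (by simp)
    (by rw [mK]; grind) (by rw [mK]; grind) (by intro k hk r; rw [mK] at *; grind)
  generalize ({a, b, c, x} : Set V) = K at *
  rcases hK with hT | ⟨X, Y, e1, e2, e3, e4, e5, e6, e7, e8, e9, e10⟩
  · have mT : ∀ w, w ∈ Kᶜ ↔ w ≠ a ∧ w ≠ b ∧ w ≠ c ∧ w ≠ x := by
      intro w; rw [Set.mem_compl_iff, mK]; tauto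
    by_cases hbc : b' = c'
    · subst hbc
      exact t.alpha h mT hT
    · exact t.beta h mT hT hbc
  · have s : Sp G a b c x b' c' X Y := by
      have sym := t.sym
      refine ⟨e1, e2, e3, ?_, ?_, ?_, ?_, ?_, ?_, ?_, ?_, ?_, ?_, ?_, e9, e10⟩ <;> grind
    have hev := t.even h
    rw [t.ecUniv s, Nat.even_iff] at hev
    rcases Nat.mod_two_eq_zero_or_one (ec G X) with hx | hx
    · exact t.gamma1 h s hx (by omega)
    · exact t.gamma2 h s hx (by omega)

end LIE

/-- In a minimal counterexample to the 3-color theorem for claw-free subcubic graphs, there is no triangle incident with a vertex of degree 2, and no triangle one of whose vertices is adjacent to a vertex of degree 1. -/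
theorem minimal_cex_no_triangle_deg2_or_pendant {V : Type*} [Fintype V] (G : SimpleGraph V)
    (hconn : G.Connected) (hdec : Decomposable G) (hclaw : ClawFree G)
    (hdeg : MaxDegreeLE G 3) (hG : ¬ HasLIEC G 3)
    (hmin : ∀ (W : Type) [Fintype W] (H : SimpleGraph W),
      Decomposable H → ClawFree H → MaxDegreeLE H 3 →
      H.edgeSet.ncard < G.edgeSet.ncard → HasLIEC H 3) :
    (¬ ∃ a b c : V, G.Adj a b ∧ G.Adj b c ∧ G.Adj a c ∧ (G.neighborSet a).ncard = 2) ∧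
      (¬ ∃ a b c x : V, G.Adj a b ∧ G.Adj b c ∧ G.Adj a c ∧ G.Adj a x ∧
        (G.neighborSet x).ncard = 1) := by
  have h := LIE.mkCtx G hconn hdec hclaw hdeg hG hmin
  refine ⟨?_, ?_⟩
  · rintro ⟨a, b, c, ab, bc, ac, hc⟩
    exact LIE.S1 h bc (LIE.nb2 hc ab ac bc.ne)
  · rintro ⟨a, b, c, x, ab, bc, ac, ax, hx⟩
    obtain ⟨y, hy⟩ := Set.ncard_eq_one.1 hx
    have nx : ∀ w, G.Adj x w ↔ w = y := by
      intro w
      rw [← SimpleGraph.mem_neighborSet, hy, Set.mem_singleton_iff]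
    have : a = y := (nx a).1 ax.symm
    subst this
    exact LIE.S2 h ab bc ac ax nx
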